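/- arXiv:1610.01521 — 3 statements merged into one kernel-verified Lean document; each statement's English description precedes it below -/
import Mathlib

section
/- There exist constants C > 0 and n0 such that for every n ≥ n0, the number A(n) of antichains in {0,1,2}^n satisfies 2^{ℓ_n(n)} ≤ A(n) ≤ 2^{(1 + C·√(log n / n))·ℓ_n(n)}. -/
/-- `ℓ_i(n)`: the number of elements of `{0,1,2}^n` whose coordinates sum to `i`. -/
noncomputable def ell (n i : ℕ) : ℕ :=
  Nat.card {x : Fin n → Fin 3 // ∑ j, (x j : ℕ) = i}

open Finset

/-- The rank of an element of `{0,1,2}^n`. -/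
def coordSum {n : ℕ} (x : Fin n → Fin 3) : ℕ := ∑ j, (x j : ℕ)

theorem ell_eq_card (n i : ℕ) :
    ell n i = #{x : Fin n → Fin 3 | coordSum x = i} := by
  rw [ell, Nat.card_eq_fintype_card, Fintype.card_subtype]
  rfl

theorem coordSum_cons {n : ℕ} (e : Fin 3) (x : Fin n → Fin 3) :
    coordSum (Fin.cons e x : Fin (n + 1) → Fin 3) = e + coordSum x := by
  simp [coordSum, Fin.sum_univ_succ]

theorem coordSum_comp_perm {n : ℕ} (x : Fin n → Fin 3) (σ : Equiv.Perm (Fin n)) :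
    coordSum (x ∘ σ) = coordSum x :=
  Equiv.sum_comp σ fun j => (x j : ℕ)

/-- A symmetric chain decomposition of `{0,1,2}^n`; the label of a chain has the rank of the
bottom element of that chain. -/
structure SymmChainLabelling (n : ℕ) where
  lab : (Fin n → Fin 3) → Fin n → Fin 3
  le_of_lab_eq : ∀ x y, lab x = lab y → coordSum x ≤ coordSum y → x ≤ y
  coordSum_lab_le : ∀ x, coordSum (lab x) ≤ coordSum x
  coordSum_add_le : ∀ x, coordSum x + coordSum (lab x) ≤ 2 * n
  exists_coordSum_eq : ∀ x r, coordSum (lab x) ≤ r → r + coordSum (lab x) ≤ 2 * n →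
    ∃ y, lab y = lab x ∧ coordSum y = r

/-- The de Bruijn–Tengbergen–Kruyswijk construction. -/
theorem nonempty_symmChainLabelling (n : ℕ) : Nonempty (SymmChainLabelling n) := by
  induction n with
  | zero =>
    refine ⟨⟨id, ?_, ?_, ?_, ?_⟩⟩
    · intro x y _ _ j
      exact j.elim0
    · simp
    · simp [coordSum]
    · intro x r h1 h2
      exact ⟨x, rfl, by simp [coordSum] at *; omega⟩
  | succ n ih =>
    obtain ⟨c⟩ := ih
    let h : Fin 3 → (Fin n → Fin 3) → Fin 3 := fun e x =>
      ⟨min e (2 * n - coordSum (c.lab x) - coordSum x), by omega⟩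
    have hh : ∀ e x, (h e x : ℕ) = min (e : ℕ) (2 * n - coordSum (c.lab x) - coordSum x) :=
      fun _ _ => rfl
    let L : (Fin (n + 1) → Fin 3) → Fin (n + 1) → Fin 3 := fun z =>
      Fin.cons (h (z 0) (Fin.tail z)) (c.lab (Fin.tail z))
    have hL : ∀ e x, L (Fin.cons e x) = Fin.cons (h e x) (c.lab x) := fun e x => by
      simp [L]
    refine ⟨⟨L, ?_, ?_, ?_, ?_⟩⟩
    · intro x y
      induction x using Fin.consCases with | _ e x => ?_
      induction y using Fin.consCases with | _ f y => ?_
      rw [hL, hL, Fin.cons_inj, coordSum_cons, coordSum_cons, Fin.cons_le_cons]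
      rintro ⟨h1, h2⟩ h3
      have h4 := congrArg Fin.val h1
      rw [hh, hh, h2] at h4
      have h5 := c.coordSum_add_le x
      have h6 := c.coordSum_add_le y
      rw [h2] at h5
      have h7 : coordSum x ≤ coordSum y := by omega
      refine ⟨?_, c.le_of_lab_eq x y h2 h7⟩
      rw [Fin.le_def]
      omega
    · intro x
      induction x using Fin.consCases with | _ e x => ?_
      rw [hL, coordSum_cons, coordSum_cons, hh]
      have := c.coordSum_lab_le x
      omega
    · intro x
      induction x using Fin.consCases with | _ e x => ?_
      rw [hL, coordSum_cons, coordSum_cons, hh]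
      have := c.coordSum_add_le x
      have := e.isLt
      omega
    · intro x r
      induction x using Fin.consCases with | _ e x => ?_
      rw [hL, coordSum_cons]
      intro h1 h2
      have h3 := c.coordSum_add_le x
      have h4 := c.coordSum_lab_le x
      have h5 := hh e x
      have h6 := e.isLt
      by_cases hr : r + coordSum (c.lab x) ≤ 2 * n
      · obtain ⟨y, hy, hyr⟩ := c.exists_coordSum_eq x (r - h e x) (by omega) (by omega)
        refine ⟨Fin.cons (h e x) y, ?_, ?_⟩
        · rw [hL, hy, Fin.cons_inj]
          refine ⟨Fin.ext ?_, rfl⟩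
          rw [hh, hy, hyr]
          omega
        · rw [coordSum_cons]
          omega
      · obtain ⟨y, hy, hyr⟩ := c.exists_coordSum_eq x (2 * n - coordSum (c.lab x) - h e x)
          (by omega) (by omega)
        refine ⟨Fin.cons ⟨r - (2 * n - coordSum (c.lab x) - h e x), by omega⟩ y, ?_, ?_⟩
        · rw [hL, hy, Fin.cons_inj]
          refine ⟨Fin.ext ?_, rfl⟩
          rw [hh, hy, hyr]
          dsimp only
          omega
        · rw [coordSum_cons]
          dsimp only
          omega

namespace SymmChainLabelling

variable {n : ℕ}

theorem eq_of_lab_eq (c : SymmChainLabelling n) {x y : Fin n → Fin 3} (h : c.lab x = c.lab y)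
    (hr : coordSum x = coordSum y) : x = y :=
  le_antisymm (c.le_of_lab_eq x y h hr.le) (c.le_of_lab_eq y x h.symm hr.ge)

/-- Every chain meets the middle layer. -/
theorem card_image_lab_le (c : SymmChainLabelling n) : #(univ.image c.lab) ≤ ell n n := by
  rw [ell_eq_card]
  refine (card_le_card (t := ({x | coordSum x = n} : Finset _).image c.lab) ?_).trans
    card_image_le
  intro l hl
  obtain ⟨x, -, rfl⟩ := mem_image.1 hl
  have h1 := c.coordSum_lab_le x
  have h2 := c.coordSum_add_le x
  obtain ⟨y, hy, hyr⟩ := c.exists_coordSum_eq x n (by omega) (by omega)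
  exact mem_image.2 ⟨y, by simpa using hyr, hy⟩

theorem three_pow_le (c : SymmChainLabelling n) : 3 ^ n ≤ (2 * n + 1) * ell n n := by
  calc 3 ^ n = #(univ : Finset (Fin n → Fin 3)) := by simp
    _ ≤ #(range (2 * n + 1) ×ˢ univ.image c.lab) := by
      refine card_le_card_of_injOn (fun x => (coordSum x, c.lab x)) ?_ ?_
      · intro x _
        have := c.coordSum_add_le x
        simp only [coe_product, Set.mem_prod, mem_coe, mem_range, mem_image_of_mem, mem_univ,
          and_true]
        omega
      · intro x _ y _ hxy
        simp only [Prod.mk.injEq] at hxy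
        exact c.eq_of_lab_eq hxy.2 hxy.1
    _ ≤ (2 * n + 1) * ell n n := by
      rw [card_product, card_range]
      exact Nat.mul_le_mul_left _ c.card_image_lab_le

/-- The permutations of the coordinates that bring `x` and `y` into a common chain. -/
def joining (c : SymmChainLabelling n) (x y : Fin n → Fin 3) : Finset (Equiv.Perm (Fin n)) :=
  {σ | c.lab (x ∘ σ) = c.lab (y ∘ σ)}

theorem card_mul_card_joining_le (c : SymmChainLabelling n) (x y : Fin n → Fin 3) (p : Fin n)
    (S : Finset (Fin n)) (hS : ∀ s ∈ S, x s = x p ∧ y s ≠ y p) :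
    #S * #(c.joining x y) ≤ n.factorial := by
  have hcard : n.factorial = #(univ : Finset (Equiv.Perm (Fin n))) := by
    simp [Fintype.card_perm]
  rw [hcard, ← card_product]
  refine card_le_card_of_injOn (fun q => Equiv.swap p q.1 * q.2)
    (fun _ _ => mem_coe.2 (mem_univ _)) ?_
  have hx : ∀ s ∈ S, ∀ σ : Equiv.Perm (Fin n), x ∘ (Equiv.swap p s * σ) = x ∘ σ := by
    intro s hs σ
    funext j
    simp only [Function.comp_apply, Equiv.Perm.mul_apply]
    have := (hS s hs).1
    rw [Equiv.swap_apply_def]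
    split_ifs with h1 h2
    · rw [h1, this]
    · rw [h2, this]
    · rfl
  rintro ⟨s, σ⟩ hsσ ⟨t, τ⟩ htτ hst
  simp only [coe_product, Set.mem_prod, mem_coe, joining, mem_filter, mem_univ, true_and]
    at hsσ htτ hst
  have hyy : y ∘ σ = y ∘ τ := by
    refine c.eq_of_lab_eq ?_ (by rw [coordSum_comp_perm, coordSum_comp_perm])
    rw [← hsσ.2, ← htτ.2, ← hx s hsσ.1 σ, ← hx t htτ.1 τ, hst]
  have hstt : s = t := by
    by_contra hne
    have hsp : s ≠ p := fun h => (hS s hsσ.1).2 (by rw [h])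
    have h1 := congrFun hyy (σ.symm p)
    have h2 : σ.symm p = τ.symm (Equiv.swap p t s) := by
      have : τ = Equiv.swap p t * (Equiv.swap p s * σ) := by
        rw [hst, ← mul_assoc, Equiv.swap_mul_self, one_mul]
      rw [Equiv.eq_symm_apply, this]
      simp
    simp only [Function.comp_apply, Equiv.apply_symm_apply] at h1
    rw [h2, Equiv.apply_symm_apply, Equiv.swap_apply_of_ne_of_ne hsp hne] at h1
    exact (hS s hsσ.1).2 h1.symm
  subst hstt
  rw [mul_right_inj] at hst
  rw [hst]

theorem le_or_le_of_mem_joining (c : SymmChainLabelling n) {x y : Fin n → Fin 3}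
    {σ : Equiv.Perm (Fin n)} (h : σ ∈ c.joining x y) : x ≤ y ∨ y ≤ x := by
  have aux : ∀ u v : Fin n → Fin 3, u ∘ σ ≤ v ∘ σ → u ≤ v := fun u v huv j => by
    simpa using huv (σ⁻¹ j)
  simp only [joining, mem_filter, mem_univ, true_and] at h
  rcases le_total (coordSum (x ∘ σ)) (coordSum (y ∘ σ)) with h1 | h1
  · exact .inl (aux _ _ (c.le_of_lab_eq _ _ h h1))
  · exact .inr (aux _ _ (c.le_of_lab_eq _ _ h.symm h1))

end SymmChainLabelling

/-- The elements of `{0,1,2}^n` that take each value on at least three tenths of the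
coordinates. -/
def balanced (n : ℕ) : Finset (Fin n → Fin 3) :=
  {x | ∀ v, 3 * n ≤ 10 * #{j | x j = v}}

theorem coordSum_eq_card_add {n : ℕ} (x : Fin n → Fin 3) :
    coordSum x = #{j | x j = 1} + 2 * #{j | x j = 2} := by
  simp only [coordSum, card_filter, mul_sum, ← sum_add_distrib]
  refine sum_congr rfl fun j _ => ?_
  generalize x j = e
  fin_cases e <;> simp

theorem card_add_card_add_card {n : ℕ} (x : Fin n → Fin 3) :
    #{j | x j = 0} + #{j | x j = 1} + #{j | x j = 2} = n := by
  calc _ = ∑ j : Fin n, 1 := by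
        simp only [card_filter, ← sum_add_distrib]
        refine sum_congr rfl fun j _ => ?_
        generalize x j = e
        fin_cases e <;> simp
    _ = n := by simp

theorem coordSum_bounds_of_mem_balanced {n : ℕ} {x : Fin n → Fin 3} (hx : x ∈ balanced n) :
    9 * n ≤ 10 * coordSum x ∧ 10 * coordSum x ≤ 11 * n := by
  simp only [balanced, mem_filter, mem_univ, true_and] at hx
  have h0 := hx 0
  have h1 := hx 1
  have h2 := hx 2
  have h3 := card_add_card_add_card x
  have h4 := coordSum_eq_card_add x
  omega

theorem card_ne_add_coordSum_le {n : ℕ} {x y : Fin n → Fin 3} (h : x ≤ y) :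
    #{j | x j ≠ y j} + coordSum x ≤ coordSum y := by
  simp only [coordSum, card_filter, ← sum_add_distrib]
  refine sum_le_sum fun j _ => ?_
  have h1 := Fin.le_def.1 (h j)
  split_ifs with h2
  · have := Fin.val_ne_of_ne h2
    omega
  · omega

theorem mul_card_joining_le {n : ℕ} (c : SymmChainLabelling n) {x y : Fin n → Fin 3}
    (hx : x ∈ balanced n) (hy : y ∈ balanced n) (hne : x ≠ y) (hxy : x ≤ y ∨ y ≤ x) :
    n * #(c.joining x y) ≤ 10 * n.factorial := by
  obtain ⟨p, hp⟩ := Function.ne_iff.1 hne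
  have hdiff : 10 * #{j | x j ≠ y j} ≤ 2 * n := by
    have hx' := coordSum_bounds_of_mem_balanced hx
    have hy' := coordSum_bounds_of_mem_balanced hy
    rcases hxy with h | h
    · have := card_ne_add_coordSum_le h
      omega
    · have := card_ne_add_coordSum_le h
      simp only [ne_comm (b := x _)] at this
      omega
  have hlevel : 3 * n ≤ 10 * #{j | x j = x p} := by
    simp only [balanced, mem_filter, mem_univ, true_and] at hx
    exact hx _
  have hsplit : #{j | x j = x p} ≤ #{j | x j = x p ∧ y j ≠ y p} + #{j | x j ≠ y j} := by
    refine (card_le_card ?_).trans (card_union_le _ _)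
    intro j hj
    simp only [mem_union, mem_filter, mem_univ, true_and] at hj ⊢
    by_cases h : y j = y p
    · exact .inr (by rwa [hj, h])
    · exact .inl ⟨hj, h⟩
  have hmain := c.card_mul_card_joining_le x y p {j | x j = x p ∧ y j ≠ y p}
    (fun s hs => by simpa using hs)
  have hS : n ≤ 10 * #{j | x j = x p ∧ y j ≠ y p} := by omega
  calc n * #(c.joining x y) ≤ 10 * #{j | x j = x p ∧ y j ≠ y p} * #(c.joining x y) :=
        Nat.mul_le_mul_right _ hS
    _ ≤ 10 * n.factorial := by
        rw [mul_assoc]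
        exact Nat.mul_le_mul_left _ hmain

theorem sq_card_le_card_mul_sum_card_fiber {α β : Type*} [DecidableEq β] (F : Finset α)
    (T : Finset β) (g : α → β) (hg : ∀ x ∈ F, g x ∈ T) :
    #F ^ 2 ≤ #T * ∑ x ∈ F, #{y ∈ F | g x = g y} := by
  have h1 : ∑ x ∈ F, #{y ∈ F | g x = g y} = ∑ b ∈ T, #{x ∈ F | g x = b} ^ 2 := by
    rw [← sum_fiberwise_of_maps_to hg]
    refine sum_congr rfl fun b _ => ?_
    rw [sq, ← smul_eq_mul, ← sum_const]
    refine sum_congr rfl fun x hx => ?_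
    rw [(mem_filter.1 hx).2]
    simp only [eq_comm]
  rw [h1, card_eq_sum_card_fiberwise hg]
  exact sq_sum_le_card_mul_sum_sq

open Classical in
/-- The elements of `F` comparable to `x` and distinct from it. -/
noncomputable def comparableIn {α : Type*} [LE α] (F : Finset α) (x : α) : Finset α :=
  {y ∈ F | x ≠ y ∧ (x ≤ y ∨ y ≤ x)}

theorem mem_comparableIn {α : Type*} [LE α] {F : Finset α} {x y : α} :
    y ∈ comparableIn F x ↔ y ∈ F ∧ x ≠ y ∧ (x ≤ y ∨ y ≤ x) := by
  simp [comparableIn]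

theorem exists_mul_card_le {n : ℕ} (c : SymmChainLabelling n) (F : Finset (Fin n → Fin 3))
    (hF : F ⊆ balanced n) (hne : F.Nonempty) :
    ∃ x ∈ F, n * #F ≤ ell n n * (n + 10 * #(comparableIn F x)) := by
  classical
  have hperm : #(univ : Finset (Equiv.Perm (Fin n))) = n.factorial := by
    simp [Fintype.card_perm]
  have h1 : ∀ σ : Equiv.Perm (Fin n),
      #F ^ 2 ≤ ell n n * ∑ x ∈ F, #{y ∈ F | c.lab (x ∘ σ) = c.lab (y ∘ σ)} := fun σ =>
    (sq_card_le_card_mul_sum_card_fiber F (univ.image c.lab) (fun x => c.lab (x ∘ σ))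
      (fun x _ => mem_image_of_mem _ (mem_univ _))).trans
      (Nat.mul_le_mul_right _ c.card_image_lab_le)
  have h2 : ∑ x ∈ F, n.factorial * #F ≤ ∑ x ∈ F, ell n n * ∑ y ∈ F, #(c.joining x y) := by
    calc ∑ x ∈ F, n.factorial * #F = ∑ σ : Equiv.Perm (Fin n), #F ^ 2 := by
          rw [sum_const, sum_const, hperm, smul_eq_mul, smul_eq_mul]
          ring
      _ ≤ ∑ σ : Equiv.Perm (Fin n),
            ell n n * ∑ x ∈ F, #{y ∈ F | c.lab (x ∘ σ) = c.lab (y ∘ σ)} :=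
          sum_le_sum fun σ _ => h1 σ
      _ = ∑ x ∈ F, ell n n * ∑ y ∈ F, #(c.joining x y) := by
          simp only [← mul_sum, card_filter, SymmChainLabelling.joining]
          rw [sum_comm]
          congr 1
          exact sum_congr rfl fun x _ => sum_comm
  obtain ⟨x, hx, hle⟩ := exists_le_of_sum_le hne h2
  refine ⟨x, hx, ?_⟩
  have h3 : n * ∑ y ∈ F, #(c.joining x y) ≤ n.factorial * (n + 10 * #(comparableIn F x)) := by
    calc n * ∑ y ∈ F, #(c.joining x y)
        = ∑ y ∈ F, n * #(c.joining x y) := mul_sum _ _ _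
      _ ≤ ∑ y ∈ F, ((if x = y then n * n.factorial else 0) +
            if x ≠ y ∧ (x ≤ y ∨ y ≤ x) then 10 * n.factorial else 0) := by
          refine sum_le_sum fun y hy => ?_
          by_cases hxy : x = y
          · rw [if_pos hxy]
            exact (Nat.mul_le_mul_left _ ((card_le_univ _).trans hperm.le)).trans
              (Nat.le_add_right _ _)
          · rw [if_neg hxy, zero_add]
            by_cases hcomp : x ≤ y ∨ y ≤ x
            · rw [if_pos ⟨hxy, hcomp⟩]
              exact mul_card_joining_le c (hF hx) (hF hy) hxy hcomp
            · have : c.joining x y = ∅ := eq_empty_of_forall_notMem fun σ hσ =>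
                hcomp (c.le_or_le_of_mem_joining hσ)
              simp [this]
      _ = n.factorial * (n + 10 * #(comparableIn F x)) := by
          have h4 : #{y ∈ F | x ≠ y ∧ (x ≤ y ∨ y ≤ x)} = #(comparableIn F x) := by
            rw [comparableIn]
            congr!
          rw [sum_add_distrib, sum_ite_eq, if_pos hx, ← sum_filter, sum_const, h4, smul_eq_mul]
          ring
  refine Nat.le_of_mul_le_mul_left ?_ n.factorial_pos
  calc n.factorial * (n * #F) = n * (n.factorial * #F) := by ring
    _ ≤ n * (ell n n * ∑ y ∈ F, #(c.joining x y)) := Nat.mul_le_mul_left _ hle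
    _ = ell n n * (n * ∑ y ∈ F, #(c.joining x y)) := by ring
    _ ≤ ell n n * (n.factorial * (n + 10 * #(comparableIn F x))) := Nat.mul_le_mul_left _ h3
    _ = _ := by ring

open Classical in
/-- The antichains contained in `F`. -/
noncomputable def antichainsIn {α : Type*} [LE α] (F : Finset α) : Finset (Finset α) :=
  {A ∈ F.powerset | IsAntichain (· ≤ ·) (A : Set α)}

section Counting

variable {α : Type*} [LE α]

theorem mem_antichainsIn {F A : Finset α} :
    A ∈ antichainsIn F ↔ A ⊆ F ∧ IsAntichain (· ≤ ·) (A : Set α) := by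
  simp [antichainsIn]

theorem card_antichainsIn_le_add [DecidableEq α] (F : Finset α) (v : α) :
    #(antichainsIn F) ≤ #(antichainsIn (F.erase v)) +
      #(antichainsIn (F.erase v \ comparableIn F v)) := by
  refine (card_le_card (t := antichainsIn (F.erase v) ∪
    (antichainsIn (F.erase v \ comparableIn F v)).image (insert v)) ?_).trans
    ((card_union_le _ _).trans (Nat.add_le_add_left card_image_le _))
  intro A hA
  rw [mem_antichainsIn] at hA
  rw [mem_union, mem_image]
  by_cases hv : v ∈ A
  · refine .inr ⟨A.erase v, mem_antichainsIn.2 ⟨fun y hy => ?_, hA.2.subset ?_⟩,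
      insert_erase hv⟩
    · obtain ⟨hyv, hyA⟩ := mem_erase.1 hy
      rw [mem_sdiff, mem_erase, mem_comparableIn]
      refine ⟨⟨hyv, hA.1 hyA⟩, fun h => ?_⟩
      rcases h.2.2 with h | h
      · exact hA.2 hv hyA hyv.symm h
      · exact hA.2 hyA hv hyv h
    · exact_mod_cast erase_subset v A
  · exact .inl (mem_antichainsIn.2 ⟨subset_erase.2 ⟨hA.1, hv⟩, hA.2⟩)

theorem card_antichainsIn_univ_le [Fintype α] [DecidableEq α] (F : Finset α) :
    #(antichainsIn (univ : Finset α)) ≤ 2 ^ #Fᶜ * #(antichainsIn F) := by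
  rw [← card_powerset, ← card_product]
  refine card_le_card_of_injOn (fun A => (A \ F, A ∩ F)) (fun A hA => ?_) fun A _ B _ hAB => ?_
  · have hA' := mem_antichainsIn.1 (mem_coe.1 hA)
    refine mem_coe.2 (mem_product.2 ⟨mem_powerset.2 fun y hy => ?_,
      mem_antichainsIn.2 ⟨inter_subset_right, hA'.2.subset ?_⟩⟩)
    · exact mem_compl.2 (mem_sdiff.1 hy).2
    · exact_mod_cast inter_subset_left
  · simp only [Prod.mk.injEq] at hAB
    rw [← sdiff_union_inter A F, hAB.1, hAB.2, sdiff_union_inter]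

theorem prod_range_mul_pow_le {δ : ℕ → ℝ} (hδ : Antitone δ) (h0 : ∀ k, 0 ≤ δ k) (a d : ℕ) {e : ℝ}
    (he : 0 ≤ e) (hle : e ≤ δ (a + d)) :
    (∏ k ∈ range a, (1 + δ (k + 1))) * (1 + e) ^ d ≤ ∏ k ∈ range (a + d), (1 + δ (k + 1)) := by
  rw [prod_range_add]
  refine mul_le_mul_of_nonneg_left ?_ (prod_nonneg fun k _ => by linarith [h0 (k + 1)])
  calc (1 + e) ^ d = ∏ _k ∈ range d, (1 + e) := by simp
    _ ≤ _ := by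
      refine prod_le_prod (fun _ _ => by linarith) fun k hk => ?_
      have : δ (a + d) ≤ δ (a + k + 1) := hδ (by have := mem_range.1 hk; omega)
      linarith

/-- If every subset `F` of `V` has an element comparable to enough others, measured by a
decreasing weight `δ`, then the number of antichains grows by a factor of at most
`1 + δ k` when the `k`-th element is added. -/
theorem card_antichainsIn_le_prod {δ : ℕ → ℝ} (hδ : Antitone δ) (h0 : ∀ k, 0 ≤ δ k) (V : Finset α)
    (H : ∀ F ⊆ V, F.Nonempty → ∃ v ∈ F, 1 ≤ δ #F * (1 + δ #F) ^ #(comparableIn F v)) :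
    ∀ F ⊆ V, (#(antichainsIn F) : ℝ) ≤ ∏ k ∈ range #F, (1 + δ (k + 1)) := by
  classical
  intro F
  induction F using Finset.strongInduction with | _ F ih => ?_
  intro hF
  rcases F.eq_empty_or_nonempty with rfl | hne
  · simp only [card_empty, range_zero, prod_empty]
    have : #(antichainsIn (∅ : Finset α)) ≤ #({∅} : Finset (Finset α)) :=
      card_le_card fun A hA => by simpa using (mem_antichainsIn.1 hA).1
    exact_mod_cast this
  · obtain ⟨v, hv, hδv⟩ := H F hF hne
    have hsub : comparableIn F v ⊆ F.erase v := fun y hy => by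
      rw [mem_comparableIn] at hy
      exact mem_erase.2 ⟨hy.2.1.symm, hy.1⟩
    have hss : F.erase v ⊂ F := erase_ssubset hv
    have h1 := ih _ hss (hss.subset.trans hF)
    have h2 := ih (F.erase v \ comparableIn F v) (sdiff_subset.trans_ssubset hss)
      ((sdiff_subset.trans hss.subset).trans hF)
    have hcard : #(F.erase v) + 1 = #F := card_erase_add_one hv
    have hcard' : #(F.erase v \ comparableIn F v) + #(comparableIn F v) = #(F.erase v) :=
      card_sdiff_add_card_eq_card hsub
    have h3 := prod_range_mul_pow_le hδ h0 #(F.erase v \ comparableIn F v) #(comparableIn F v)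
      (h0 #F) (hδ (by omega))
    rw [hcard'] at h3
    have h4 : (#(antichainsIn F) : ℝ) ≤ #(antichainsIn (F.erase v)) +
        #(antichainsIn (F.erase v \ comparableIn F v)) := by
      exact_mod_cast card_antichainsIn_le_add F v
    rw [← hcard, prod_range_succ, hcard]
    set P := ∏ k ∈ range #(F.erase v), (1 + δ (k + 1))
    set Q := ∏ k ∈ range #(F.erase v \ comparableIn F v), (1 + δ (k + 1))
    have hQ : 0 ≤ Q := prod_nonneg fun k _ => by linarith [h0 (k + 1)]
    have h5 : Q ≤ δ #F * P := by
      calc Q ≤ Q * (δ #F * (1 + δ #F) ^ #(comparableIn F v)) := le_mul_of_one_le_right hQ hδv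
        _ = δ #F * (Q * (1 + δ #F) ^ #(comparableIn F v)) := by ring
        _ ≤ δ #F * P := mul_le_mul_of_nonneg_left h3 (h0 _)
    linarith

end Counting

theorem two_pow_ell_le_card_antichainsIn {n : ℕ} (i : ℕ) :
    2 ^ ell n i ≤ #(antichainsIn (univ : Finset (Fin n → Fin 3))) := by
  rw [ell_eq_card, ← card_powerset]
  refine card_le_card fun A hA => mem_antichainsIn.2 ⟨subset_univ _, ?_⟩
  intro x hx y hy hne hxy
  have h1 := (mem_filter.1 (mem_powerset.1 hA hx)).2
  have h2 := (mem_filter.1 (mem_powerset.1 hA hy)).2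
  have h3 := card_ne_add_coordSum_le hxy
  obtain ⟨j, hj⟩ := Function.ne_iff.1 hne
  have h4 : 0 < #{j | x j ≠ y j} := card_pos.2 ⟨j, by simpa using hj⟩
  omega

theorem sum_pow_card_eq {n : ℕ} (v : Fin 3) (t : ℝ) :
    ∑ x : Fin n → Fin 3, t ^ #{j | x j = v} = (2 + t) ^ n := by
  have h1 : ∀ x : Fin n → Fin 3, t ^ #{j | x j = v} = ∏ j, if x j = v then t else 1 := fun x => by
    rw [prod_ite, prod_const, prod_const_one, mul_one]
  have h2 : ∑ e : Fin 3, (if e = v then t else 1) = 2 + t := by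
    fin_cases v <;> simp [Fin.sum_univ_three] <;> ring
  have h3 := prod_univ_sum (fun _ : Fin n => (univ : Finset (Fin 3)))
    fun _ e => if e = v then t else 1
  rw [Fintype.piFinset_univ] at h3
  simp only [h1, ← h3, h2, prod_const, card_univ, Fintype.card_fin]

/-- All but an exponentially small proportion of `{0,1,2}^n` is balanced. -/
theorem exists_card_compl_balanced_le :
    ∃ ρ : ℝ, 0 < ρ ∧ ρ < 1 ∧ ∀ n : ℕ, (#(balanced n)ᶜ : ℝ) ≤ 3 * ρ ^ n * 3 ^ n := by
  set q : ℝ := (6 / 7 : ℝ) ^ (3 / 10 : ℝ) with hq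
  have hq0 : 0 < q := by positivity
  have hq10 : q ^ 10 = (6 / 7) ^ 3 := by
    rw [hq, ← Real.rpow_natCast, ← Real.rpow_mul (by norm_num), ← Real.rpow_natCast]
    norm_num
  have hlt : 20 / 21 < q := by
    refine lt_of_pow_lt_pow_left₀ 10 hq0.le ?_
    rw [hq10]
    norm_num
  refine ⟨20 / 21 / q, by positivity, (div_lt_one hq0).2 hlt, fun n => ?_⟩
  have key : ∀ v : Fin 3,
      (#{x : Fin n → Fin 3 | ¬ 3 * n ≤ 10 * #{j | x j = v}} : ℝ) * q ^ n ≤ (20 / 7) ^ n := by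
    intro v
    have hs := sum_pow_card_eq (n := n) v (6 / 7)
    rw [show (2 + 6 / 7 : ℝ) = 20 / 7 by norm_num] at hs
    rw [← hs, ← nsmul_eq_mul, ← sum_const]
    refine (sum_le_sum fun x hx => ?_).trans
      (sum_le_sum_of_subset_of_nonneg (subset_univ _) fun _ _ _ => by positivity)
    have hx' : 10 * #{j | x j = v} ≤ 3 * n := by
      have := (mem_filter.1 hx).2
      omega
    refine le_of_pow_le_pow_left₀ (n := 10) (by norm_num) (by positivity) ?_
    rw [← pow_mul, ← pow_mul, mul_comm n, pow_mul, hq10, ← pow_mul]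
    exact pow_le_pow_of_le_one (by norm_num) (by norm_num) (by omega)
  have hsub : (balanced n)ᶜ ⊆
      univ.biUnion fun v : Fin 3 =>
        ({x : Fin n → Fin 3 | ¬ 3 * n ≤ 10 * #{j | x j = v}} : Finset _) := by
    intro x hx
    simpa [balanced] using hx
  have hcard : (#(balanced n)ᶜ : ℝ) ≤
      ∑ v : Fin 3, (#{x : Fin n → Fin 3 | ¬ 3 * n ≤ 10 * #{j | x j = v}} : ℝ) := by
    exact_mod_cast (card_le_card hsub).trans card_biUnion_le
  refine hcard.trans ((sum_le_sum (g := fun _ => (20 / 21 / q) ^ n * 3 ^ n) fun v _ => ?_).trans_eq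
    (by simp; ring))
  rw [← mul_pow, show 20 / 21 / q * 3 = 20 / 7 / q by ring, div_pow, le_div_iff₀ (by positivity)]
  exact key v

theorem prod_one_add_div_max_le {L K : ℝ} (hK : 0 < K) {m₀ m : ℕ} (hm₀ : L + K ≤ m₀)
    (hm : m₀ ≤ m) :
    ∏ k ∈ range m, (1 + K / max K (((k + 1 : ℕ) : ℝ) - L)) ≤ 2 ^ m₀ * ((m - L) / K) ^ K := by
  induction m, hm using Nat.le_induction with
  | base =>
    have h1 : ∏ k ∈ range m₀, (1 + K / max K (((k + 1 : ℕ) : ℝ) - L)) ≤ 2 ^ m₀ := by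
      calc _ ≤ ∏ _k ∈ range m₀, (2 : ℝ) := by
            refine prod_le_prod (fun k _ => by positivity) fun k _ => ?_
            have : K / max K (((k + 1 : ℕ) : ℝ) - L) ≤ 1 :=
              (div_le_one (by positivity)).2 (le_max_left _ _)
            linarith
        _ = 2 ^ m₀ := by simp
    refine h1.trans (le_mul_of_one_le_right (by positivity) (Real.one_le_rpow ?_ hK.le))
    rw [le_div_iff₀ hK]
    linarith
  | succ m hm ih =>
    have hmL : L + K ≤ m := hm₀.trans (by exact_mod_cast hm)
    rw [prod_range_succ]
    push_cast
    set j : ℝ := (m : ℝ) + 1 - L with hj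
    have hjK : K + 1 ≤ j := by rw [hj]; linarith
    have hj0 : 0 < j := by linarith
    rw [max_eq_right (by linarith)]
    have hsplit : ((m - L) / K) ^ K = (j / K) ^ K * ((j - 1) / j) ^ K := by
      rw [← Real.mul_rpow (by positivity) (div_nonneg (by linarith) hj0.le)]
      congr 1
      rw [show (m : ℝ) - L = j - 1 by rw [hj]; ring]
      field_simp
    have hdecay : ((j - 1) / j) ^ K * (1 + K / j) ≤ 1 := by
      have h1 : ((j - 1) / j) ^ K ≤ Real.exp (-(K / j)) := by
        calc ((j - 1) / j) ^ K ≤ Real.exp (-(1 / j)) ^ K := by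
              refine Real.rpow_le_rpow (div_nonneg (by linarith) hj0.le) ?_ hK.le
              have := Real.add_one_le_exp (-(1 / j))
              rw [sub_div, div_self hj0.ne']
              linarith
          _ = Real.exp (-(K / j)) := by
              rw [← Real.exp_mul]
              congr 1
              ring
      have h2 : 1 + K / j ≤ Real.exp (K / j) := by
        have := Real.add_one_le_exp (K / j)
        linarith
      calc _ ≤ Real.exp (-(K / j)) * Real.exp (K / j) :=
            mul_le_mul h1 h2 (by positivity) (Real.exp_pos _).le
        _ = 1 := by rw [← Real.exp_add, neg_add_cancel, Real.exp_zero]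
    push_cast at ih
    calc _ ≤ 2 ^ m₀ * ((m - L) / K) ^ K * (1 + K / j) :=
          mul_le_mul_of_nonneg_right ih (by positivity)
      _ = 2 ^ m₀ * (j / K) ^ K * (((j - 1) / j) ^ K * (1 + K / j)) := by
          rw [hsplit]
          ring
      _ ≤ 2 ^ m₀ * (j / K) ^ K := mul_le_of_le_one_right (by positivity) hdecay

theorem exp_half_le_one_add {δ : ℝ} (h0 : 0 ≤ δ) (h1 : δ ≤ 1) : Real.exp (δ / 2) ≤ 1 + δ := by
  rw [← Real.le_log_iff_exp_le (by linarith)]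
  refine le_trans ?_ (Real.one_sub_inv_le_log_of_pos (by linarith))
  rw [le_sub_iff_add_le, ← le_sub_iff_add_le', inv_le_iff_one_le_mul₀ (by linarith)]
  nlinarith

theorem exists_comparable_weight {n : ℕ} (hn : 1 ≤ Real.log n) (c : SymmChainLabelling n)
    {L K : ℝ} (hL : L = ell n n) (hL0 : 0 < L) (hK : K = 40 * L * Real.log n / n)
    (F : Finset (Fin n → Fin 3)) (hF : F ⊆ balanced n) (hne : F.Nonempty) :
    ∃ v ∈ F, 1 ≤ K / max K (#F - L) * (1 + K / max K (#F - L)) ^ #(comparableIn F v) := by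
  obtain ⟨x, hx, hdeg⟩ := exists_mul_card_le c F hF hne
  refine ⟨x, hx, ?_⟩
  have hn0 : (0 : ℝ) < n := by
    rcases Nat.eq_zero_or_pos n with rfl | h
    · norm_num at hn
    · exact_mod_cast h
  have hK0 : 0 < K := by rw [hK]; positivity
  rcases le_or_gt (#F - L) K with hj | hj
  · rw [max_eq_left hj, div_self hK0.ne', one_mul]
    exact one_le_pow₀ (by norm_num)
  rw [max_eq_right hj.le]
  set j : ℝ := #F - L with hjdef
  have hj0 : 0 < j := hK0.trans hj
  set d : ℕ := #(comparableIn F x)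
  have hdeg' : n * (#F : ℝ) ≤ L * (n + 10 * d) := by
    rw [hL]
    exact_mod_cast hdeg
  have hjd : n * j ≤ 10 * L * d := by
    rw [hjdef]
    linarith
  have hjle : j ≤ 2 * n * L := by
    have h1 : #F ≤ (2 * n + 1) * ell n n := by
      refine (card_le_univ F).trans (le_trans ?_ c.three_pow_le)
      simp
    have h2 : (#F : ℝ) ≤ (2 * n + 1) * L := by
      rw [hL]
      exact_mod_cast h1
    rw [hjdef]
    linarith
  have hδd : 2 * Real.log n ≤ K / j / 2 * d := by
    rw [div_div, div_mul_eq_mul_div, le_div_iff₀ (by positivity), hK, div_mul_eq_mul_div,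
      le_div_iff₀ hn0]
    have := mul_le_mul_of_nonneg_left hjd (by linarith : 0 ≤ 4 * Real.log n)
    linarith
  have hpow : (n : ℝ) ^ 2 ≤ (1 + K / j) ^ d := by
    calc (n : ℝ) ^ 2 = Real.exp (2 * Real.log n) := by
          rw [two_mul, Real.exp_add, Real.exp_log hn0, sq]
      _ ≤ Real.exp (K / j / 2 * d) := Real.exp_le_exp.2 hδd
      _ = Real.exp (K / j / 2) ^ d := by rw [mul_comm, Real.exp_nat_mul]
      _ ≤ (1 + K / j) ^ d := pow_le_pow_left₀ (Real.exp_pos _).le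
          (exp_half_le_one_add (by positivity) ((div_le_one hj0).2 hj.le)) _
  have hδ : 1 ≤ K / j * n ^ 2 := by
    rw [div_mul_eq_mul_div, le_div_iff₀ hj0, hK, div_mul_eq_mul_div, le_div_iff₀ hn0]
    have h1 : j * n ≤ 2 * n * L * n := mul_le_mul_of_nonneg_right hjle hn0.le
    have h2 : 0 ≤ L * n ^ 2 * (Real.log n - 1) := by
      have : 0 ≤ Real.log n - 1 := by linarith
      positivity
    have h3 : 0 ≤ L * n ^ 2 := by positivity
    nlinarith
  exact hδ.trans (mul_le_mul_of_nonneg_left hpow (by positivity))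

theorem card_antichainsIn_balanced_le {n : ℕ} (hn : 1 ≤ Real.log n)
    (hn' : 40 * Real.log n ≤ n) (hL1 : 1 ≤ ell n n) :
    (#(antichainsIn (balanced n)) : ℝ) ≤
      2 ^ ((ell n n : ℝ) + 1 + 200 * (ell n n * (Real.log n ^ 2 / n))) := by
  obtain ⟨c⟩ := nonempty_symmChainLabelling n
  set L : ℝ := (ell n n : ℝ) with hL
  set K : ℝ := 40 * L * Real.log n / n with hK
  have hL1' : 1 ≤ L := by rw [hL]; exact_mod_cast hL1
  have hL0 : 0 < L := by linarith
  have hn0 : (0 : ℝ) < n := by linarith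
  have hn1 : (1 : ℝ) ≤ n := by linarith
  have hK0 : 0 < K := by rw [hK]; positivity
  have hKL : K ≤ L := by
    rw [hK, div_le_iff₀ hn0]
    nlinarith
  have hanti : Antitone fun k : ℕ => K / max K ((k : ℝ) - L) := fun a b hab =>
    div_le_div_of_nonneg_left hK0.le (by positivity)
      (max_le_max le_rfl (sub_le_sub_right (by exact_mod_cast hab) _))
  have hnonneg : ∀ k : ℕ, 0 ≤ K / max K ((k : ℝ) - L) := fun k => by positivity
  have h1 := card_antichainsIn_le_prod hanti hnonneg (balanced n)
    (fun F hF hne => exists_comparable_weight hn c hL hL0 hK F hF hne) _ subset_rfl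
  set M : ℕ := (2 * n + 1) * ell n n with hM
  have hMr : (M : ℝ) = (2 * n + 1) * L := by rw [hM, hL]; push_cast; ring
  have h2 : #(balanced n) ≤ M := by
    refine (card_le_univ _).trans (le_trans ?_ c.three_pow_le)
    simp
  have h3 : ∏ k ∈ range #(balanced n), (1 + K / max K (((k + 1 : ℕ) : ℝ) - L)) ≤
      ∏ k ∈ range M, (1 + K / max K (((k + 1 : ℕ) : ℝ) - L)) := by
      simpa [Nat.add_sub_cancel' h2] using prod_range_mul_pow_le hanti hnonneg #(balanced n)
        (M - #(balanced n)) le_rfl (hnonneg _)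
  have hceil : (⌈L + K⌉₊ : ℝ) < L + K + 1 := Nat.ceil_lt_add_one (by positivity)
  have hm₀M : ⌈L + K⌉₊ ≤ M := by
    refine Nat.ceil_le.2 ?_
    rw [hMr]
    nlinarith
  have h4 := prod_one_add_div_max_le hK0 (Nat.le_ceil (L + K)) hm₀M
  have hratio : (M - L) / K ≤ (n : ℝ) ^ 2 := by
    rw [div_le_iff₀ hK0, hMr, hK, mul_div_assoc', le_div_iff₀ hn0]
    have : 0 ≤ L * n ^ 2 * (Real.log n - 1) := by
      have : 0 ≤ Real.log n - 1 := by linarith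
      positivity
    have : 0 ≤ L * n ^ 2 := by positivity
    nlinarith
  have hnpow : ((n : ℝ) ^ 2) ^ K ≤ 2 ^ (4 * Real.log n * K) := by
    rw [← Real.rpow_natCast, ← Real.rpow_mul hn0.le, Real.rpow_def_of_pos hn0,
      Real.rpow_def_of_pos two_pos, Real.exp_le_exp]
    have h5 := Real.log_two_gt_d9
    have h6 : 0 ≤ Real.log n * K := by positivity
    push_cast
    nlinarith
  calc (#(antichainsIn (balanced n)) : ℝ)
      ≤ 2 ^ ⌈L + K⌉₊ * ((M - L) / K) ^ K := h1.trans (h3.trans h4)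
    _ ≤ 2 ^ (L + K + 1) * 2 ^ (4 * Real.log n * K) := by
        refine mul_le_mul ?_ ((Real.rpow_le_rpow ?_ hratio hK0.le).trans hnpow) (by
          refine Real.rpow_nonneg (div_nonneg ?_ hK0.le) _
          rw [hMr]; nlinarith) (by positivity)
        · rw [← Real.rpow_natCast]
          exact Real.rpow_le_rpow_of_exponent_le one_le_two hceil.le
        · refine div_nonneg ?_ hK0.le
          rw [hMr]
          nlinarith
    _ = 2 ^ (L + K + 1 + 4 * Real.log n * K) := (Real.rpow_add two_pos _ _).symm
    _ ≤ _ := by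
        refine Real.rpow_le_rpow_of_exponent_le one_le_two ?_
        have h7 : K ≤ K * Real.log n := le_mul_of_one_le_right hK0.le hn
        have h8 : 5 * (K * Real.log n) = 200 * (L * (Real.log n ^ 2 / n)) := by
          rw [hK]
          ring
        linarith

open Filter Topology in
theorem eventually_bounds {ρ : ℝ} (h0 : 0 < ρ) (h1 : ρ < 1) :
    ∀ᶠ n : ℕ in atTop, 1 ≤ Real.log n ∧ 40 * Real.log n ≤ n ∧ Real.log n ^ 3 ≤ n ∧
      (2 * n + 1) * n ≤ (3 : ℝ) ^ n ∧ 3 * (2 * n + 1) * n * ρ ^ n ≤ 1 := by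
  have hcast : Tendsto (fun n : ℕ => (n : ℝ)) atTop atTop := tendsto_natCast_atTop_atTop
  have e1 : ∀ᶠ n : ℕ in atTop, 1 ≤ Real.log n :=
    (Real.tendsto_log_atTop.comp hcast).eventually_ge_atTop 1
  have e2 : ∀ᶠ n : ℕ in atTop, ‖Real.log n ^ 1‖ ≤ 1 / 40 * ‖id (n : ℝ)‖ :=
    hcast.eventually ((Real.isLittleO_pow_log_id_atTop (n := 1)).bound (by norm_num))
  have e3 : ∀ᶠ n : ℕ in atTop, ‖Real.log n ^ 3‖ ≤ 1 * ‖id (n : ℝ)‖ :=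
    hcast.eventually ((Real.isLittleO_pow_log_id_atTop (n := 3)).bound one_pos)
  have geom : ∀ r : ℝ, 0 < r → r < 1 → ∀ᶠ n : ℕ in atTop, (n : ℝ) ^ 2 * r ^ n ≤ 1 / 9 :=
    fun r hr0 hr1 => (tendsto_pow_const_mul_const_pow_of_abs_lt_one 2
      (by rwa [abs_of_pos hr0])).eventually_le_const (by norm_num)
  filter_upwards [e1, e2, e3, geom ρ h0 h1, geom (1 / 3) (by norm_num) (by norm_num),
    eventually_ge_atTop 1] with n a1 a2 a3 a4 a5 a6
  have hn : (1 : ℝ) ≤ n := by exact_mod_cast a6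
  have hsq : (2 * n + 1) * n ≤ 3 * (n : ℝ) ^ 2 := by nlinarith
  refine ⟨a1, ?_, ?_, ?_, ?_⟩
  · simp only [pow_one, id, Real.norm_eq_abs, Nat.abs_cast] at a2
    linarith [le_abs_self (Real.log n)]
  · simp only [id, Real.norm_eq_abs, Nat.abs_cast, one_mul] at a3
    exact (le_abs_self _).trans a3
  · rw [one_div, inv_pow, ← div_eq_mul_inv, div_le_iff₀ (by positivity)] at a5
    linarith [pow_pos (zero_lt_three' ℝ) n]
  · have := mul_le_mul_of_nonneg_right hsq (pow_nonneg h0.le n)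
    linarith

/-- The number of antichains in the poset `{0,1,2}^n` is
`2^{(1 + O(√(log n / n))) ℓ_n(n)}`. -/
theorem countAntichainsMultiset :
    ∃ C : ℝ, 0 < C ∧ ∃ n0 : ℕ, ∀ n : ℕ, n0 ≤ n →
      2 ^ ell n n ≤
        Nat.card {A : Finset (Fin n → Fin 3) //
          IsAntichain (· ≤ ·) (A : Set (Fin n → Fin 3))} ∧
      (Nat.card {A : Finset (Fin n → Fin 3) //
          IsAntichain (· ≤ ·) (A : Set (Fin n → Fin 3))} : ℝ) ≤
        (2 : ℝ) ^ ((1 + C * Real.sqrt (Real.log n / n)) * (ell n n : ℝ)) := by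
  obtain ⟨ρ, hρ0, hρ1, hρ⟩ := exists_card_compl_balanced_le
  obtain ⟨n0, hn0⟩ := Filter.eventually_atTop.1 (eventually_bounds hρ0 hρ1)
  refine ⟨202, by norm_num, n0, fun n hn => ?_⟩
  have hcard : Nat.card {A : Finset (Fin n → Fin 3) //
      IsAntichain (· ≤ ·) (A : Set (Fin n → Fin 3))} =
      #(antichainsIn (univ : Finset (Fin n → Fin 3))) := by
    classical
    rw [Nat.card_eq_fintype_card, Fintype.card_subtype]
    congr 1
  rw [hcard]
  refine ⟨two_pow_ell_le_card_antichainsIn n, ?_⟩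
  obtain ⟨hlog, hlogn, hlog3, hpow, hgeom⟩ := hn0 n hn
  obtain ⟨c⟩ := nonempty_symmChainLabelling n
  have hnpos : (0 : ℝ) < n := by linarith
  set L : ℝ := (ell n n : ℝ) with hL
  have h3L : (3 : ℝ) ^ n ≤ (2 * n + 1) * L := by
    rw [hL]
    exact_mod_cast c.three_pow_le
  have hnL : (n : ℝ) ≤ L := le_of_mul_le_mul_left (hpow.trans h3L) (by positivity)
  have hL1 : 1 ≤ ell n n := by
    have : (1 : ℝ) ≤ L := by linarith
    rw [hL] at this
    exact_mod_cast this
  have hinv : 1 / (n : ℝ) ≤ Real.log n ^ 2 / n :=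
    div_le_div_of_nonneg_right (one_le_pow₀ hlog) hnpos.le
  have hL0 : 0 < L := by linarith
  have hone : 1 ≤ L * (Real.log n ^ 2 / n) := by
    calc (1 : ℝ) = n * (1 / n) := by field_simp
      _ ≤ _ := mul_le_mul hnL hinv (by positivity) hL0.le
  have hbad : (#(balanced n)ᶜ : ℝ) ≤ L * (Real.log n ^ 2 / n) := by
    refine le_trans ?_ (mul_le_mul_of_nonneg_left hinv hL0.le)
    rw [mul_one_div, le_div_iff₀ hnpos]
    calc (#(balanced n)ᶜ : ℝ) * n ≤ 3 * ρ ^ n * ((2 * n + 1) * L) * n := by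
          refine mul_le_mul_of_nonneg_right ((hρ n).trans ?_) hnpos.le
          exact mul_le_mul_of_nonneg_left h3L (by positivity)
      _ = 3 * (2 * n + 1) * n * ρ ^ n * L := by ring
      _ ≤ L := mul_le_of_le_one_left hL0.le hgeom
  have hsqrt : Real.log n ^ 2 / n ≤ Real.sqrt (Real.log n / n) := by
    refine Real.le_sqrt_of_sq_le ?_
    rw [div_pow, div_le_div_iff₀ (by positivity) hnpos]
    have : 0 ≤ Real.log n * n * (n - Real.log n ^ 3) :=
      mul_nonneg (by positivity) (by linarith)
    linarith
  calc (#(antichainsIn (univ : Finset (Fin n → Fin 3))) : ℝ)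
      ≤ 2 ^ #(balanced n)ᶜ * #(antichainsIn (balanced n)) := by
        exact_mod_cast card_antichainsIn_univ_le (balanced n)
    _ ≤ 2 ^ (#(balanced n)ᶜ : ℝ) * 2 ^ (L + 1 + 200 * (L * (Real.log n ^ 2 / n))) := by
        rw [Real.rpow_natCast]
        exact mul_le_mul_of_nonneg_left (card_antichainsIn_balanced_le hlog hlogn hL1)
          (by positivity)
    _ = 2 ^ (#(balanced n)ᶜ + (L + 1 + 200 * (L * (Real.log n ^ 2 / n)))) :=
        (Real.rpow_add two_pos _ _).symm
    _ ≤ _ := by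
        refine Real.rpow_le_rpow_of_exponent_le one_le_two ?_
        have := mul_le_mul_of_nonneg_left hsqrt hL0.le
        linarith
end

section
/- There exist constants C > 0 and n0 such that for every n ≥ n0, the number of antichains in the boolean lattice P(n) is at most 2^{(1 + C·√(log n / n))·C(n, ⌈n/2⌉)}, where C(a,b) denotes the binomial coefficient. -/
open Finset

namespace AntichainCount

section Recursion

variable {α : Type*} [PartialOrder α]

open Classical in
/-- The antichains contained in `S`. -/
noncomputable def antichains (S : Finset α) : Finset (Finset α) :=
  {I ∈ S.powerset | IsAntichain (· ≤ ·) (I : Set α)}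

open Classical in
/-- The elements of `S` comparable to `v` and different from it. -/
noncomputable def nbrs (S : Finset α) (v : α) : Finset α := {u ∈ S | u < v ∨ v < u}

lemma mem_antichains {S I : Finset α} :
    I ∈ antichains S ↔ I ⊆ S ∧ IsAntichain (· ≤ ·) (I : Set α) := by
  simp [antichains]

lemma card_antichains_le_two_pow (S : Finset α) : #(antichains S) ≤ 2 ^ #S := by
  classical
  rw [← card_powerset]
  exact card_le_card (filter_subset _ _)

open Classical in
/-- Antichains of `S` either avoid `v`, or contain `v` and avoid its neighbours. -/
lemma card_antichains_le_add (S : Finset α) (v : α) :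
    #(antichains S) ≤
      #(antichains (S.erase v)) + #(antichains ((S.erase v) \ nbrs S v)) := by
  rw [← card_filter_add_card_filter_not (s := antichains S) (fun I ↦ v ∉ I)]
  refine add_le_add (card_le_card ?_) (card_le_card_of_injOn (fun I ↦ I.erase v) ?_ ?_)
  · intro I hI
    rw [mem_filter, mem_antichains] at hI
    exact mem_antichains.2 ⟨subset_erase.2 ⟨hI.1.1, hI.2⟩, hI.1.2⟩
  · intro I hI
    simp only [coe_filter, Set.mem_ofPred_eq, mem_antichains, not_not] at hI
    obtain ⟨⟨hIS, hI⟩, hv⟩ := hI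
    refine mem_antichains.2 ⟨fun u hu ↦ ?_, hI.subset (coe_subset.2 (erase_subset _ _))⟩
    obtain ⟨huv, huI⟩ := mem_erase.1 hu
    refine mem_sdiff.2 ⟨mem_erase.2 ⟨huv, hIS huI⟩, fun h ↦ ?_⟩
    rcases (mem_filter.1 h).2 with h | h
    · exact hI huI hv huv h.le
    · exact hI hv huI (Ne.symm huv) h.le
  · intro I hI J hJ hIJ
    simp only [coe_filter, Set.mem_ofPred_eq, not_not] at hI hJ
    rw [← insert_erase hI.2, ← insert_erase hJ.2]
    exact congrArg (insert v) hIJ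

/-- If every large subset of `V` contains an element comparable to at least `d` others, then the
number of antichains in `V` exceeds the one in small subsets by a controlled factor. -/
lemma card_antichains_le_mul_exp {V : Finset α} {m d t K : ℝ} (ht : 0 ≤ t)
    (htd : Real.exp (-(t * d)) ≤ t)
    (hdeg : ∀ T ⊆ V, m < #T → ∃ v ∈ T, d ≤ #(nbrs T v))
    (hK : ∀ T ⊆ V, (#T : ℝ) ≤ m → (#(antichains T) : ℝ) ≤ K) :
    (#(antichains V) : ℝ) ≤ K * Real.exp (t * #V) := by
  classical
  have hK0 : 0 ≤ K ∨ m < 0 := by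
    by_cases h : 0 ≤ m
    · exact .inl ((Nat.cast_nonneg _).trans (hK ∅ (empty_subset _) (by simpa using h)))
    · exact .inr (not_le.1 h)
  replace hK0 : 0 ≤ K := by
    rcases hK0 with h | h
    · exact h
    · obtain ⟨v, hv, -⟩ := hdeg ∅ (empty_subset _) (by simpa using h)
      simp at hv
  suffices H : ∀ s : ℕ, ∀ T ⊆ V, #T = s → (#(antichains T) : ℝ) ≤ K * Real.exp (t * #T) from
    H _ V Subset.rfl rfl
  intro s
  induction s using Nat.strong_induction_on with
  | _ s ih =>
  intro T hTV hs
  rcases le_or_gt (#T : ℝ) m with hm | hm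
  · refine (hK T hTV hm).trans (le_mul_of_one_le_right hK0 (Real.one_le_exp (by positivity)))
  obtain ⟨v, hv, hd⟩ := hdeg T hTV hm
  have hlt : #(T.erase v) < s := hs ▸ card_erase_lt_of_mem hv
  have hlt' : #(T.erase v \ nbrs T v) < s := (card_le_card sdiff_subset).trans_lt hlt
  have h1 := ih _ hlt _ ((erase_subset _ _).trans hTV) rfl
  have h2 := ih _ hlt' _ (sdiff_subset.trans ((erase_subset _ _).trans hTV)) rfl
  have hc1 : (#(T.erase v) : ℝ) = #T - 1 := by
    rw [← card_erase_add_one hv]; push_cast; ring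
  have hsub : nbrs T v ⊆ T.erase v := by
    intro u hu
    obtain ⟨hu, h⟩ := mem_filter.1 hu
    refine mem_erase.2 ⟨?_, hu⟩
    rintro rfl
    simp at h
  have hc2 : (#(T.erase v \ nbrs T v) : ℝ) ≤ #T - 1 - d := by
    rw [cast_card_sdiff hsub, hc1]
    linarith
  have h3 : Real.exp (t * #(T.erase v \ nbrs T v)) ≤ Real.exp (t * (#T - 1 - d)) :=
    Real.exp_le_exp.2 (mul_le_mul_of_nonneg_left hc2 ht)
  calc (#(antichains T) : ℝ)
      ≤ #(antichains (T.erase v)) + #(antichains (T.erase v \ nbrs T v)) := by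
        exact_mod_cast card_antichains_le_add T v
    _ ≤ K * Real.exp (t * (#T - 1)) + K * Real.exp (t * (#T - 1 - d)) := by
        rw [hc1] at h1
        exact add_le_add h1 (h2.trans (mul_le_mul_of_nonneg_left h3 hK0))
    _ = K * Real.exp (t * (#T - 1)) * (1 + Real.exp (-(t * d))) := by
        have : t * ((#T : ℝ) - 1 - d) = t * (#T - 1) + -(t * d) := by ring
        rw [this, Real.exp_add]
        ring
    _ ≤ K * Real.exp (t * (#T - 1)) * Real.exp t := by
        refine mul_le_mul_of_nonneg_left ?_ (by positivity)
        linarith [Real.add_one_le_exp t]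
    _ = K * Real.exp (t * #T) := by
        rw [mul_assoc, ← Real.exp_add]
        ring_nf

/-- Discarding `S \ V` loses at most a factor `2 ^ #(S \ V)` of the antichains of `S`. -/
lemma card_antichains_le_mul_two_pow [DecidableEq α] (S V : Finset α) :
    #(antichains S) ≤ #(antichains (S ∩ V)) * 2 ^ #(S \ V) := by
  rw [← card_powerset, ← card_product]
  refine card_le_card_of_injOn (fun I ↦ (I ∩ V, I \ V)) ?_ ?_
  · intro I hI
    obtain ⟨hIS, hI⟩ := mem_antichains.1 (mem_coe.1 hI)
    exact mem_coe.2 <| mem_product.2 ⟨mem_antichains.2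
      ⟨inter_subset_inter_right hIS, hI.subset (coe_subset.2 inter_subset_left)⟩,
      mem_powerset.2 (sdiff_subset_sdiff hIS Subset.rfl)⟩
  · intro I _ J _ hIJ
    obtain ⟨h1, h2⟩ := Prod.mk.inj hIJ
    rw [← sdiff_union_inter I V, ← sdiff_union_inter J V, h1, h2]

end Recursion

section Supersaturation

lemma choose_le_choose_of_le_of_add_le {a b k : ℕ} (hka : k ≤ a) (hab : a + k ≤ b) :
    b.choose k ≤ b.choose a := by
  have h := Nat.choose_mul (n := b) (k := a) (s := k) hka
  have h1 : a.choose k ≤ (b - k).choose (a - k) := by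
    rw [← Nat.choose_symm hka]
    exact Nat.choose_le_choose _ (by omega)
  have h2 : 0 < a.choose k := Nat.choose_pos hka
  refine Nat.le_of_mul_le_mul_right ?_ h2
  rw [h]
  exact Nat.mul_le_mul_left _ h1

open Numbering Fintype

variable {X : Type*} [Fintype X] [DecidableEq X]

open scoped Nat in
lemma card_prefixed_inter_le {A B : Finset X} (hAB : A ⊆ B) :
    #(prefixed A ∩ prefixed B) ≤ (#A)! * (#B - #A)! * (card X - #B)! := by
  have hc : #(prefixed (A.subtype (· ∈ B)) ×ˢ (univ : Finset (Numbering ↑(Bᶜ)))) =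
      (#A)! * (#B - #A)! * (card X - #B)! := by
    rw [card_product, card_prefixed, card_univ, card_numbering]
    have : #(A.subtype (· ∈ B)) = #A := by
      rw [card_subtype, filter_true_of_mem fun x hx ↦ hAB hx]
    simp [this]
  rw [← hc, ← card_attach (s := prefixed A ∩ prefixed B)]
  refine card_le_card_of_injOn
    (fun f ↦ prefixedEquiv B ⟨f.1, (mem_inter.1 f.2).2⟩) ?_ ?_
  · intro f _
    have hf := mem_prefixed.1 (mem_inter.1 f.2).1
    have hs : #(A.subtype (· ∈ B)) = #A := by
      rw [card_subtype, filter_true_of_mem fun x hx ↦ hAB hx]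
    refine mem_coe.2 (mem_product.2 ⟨mem_prefixed.2 fun x ↦ ?_, mem_univ _⟩)
    rw [mem_subtype, hs]
    exact hf x
  · intro f _ g _ hfg
    have := (prefixedEquiv B).injective hfg
    exact Subtype.ext (congrArg (fun z ↦ z.1) this)

lemma card_prefixed_inter_mul_choose_le {A B : Finset X} (hAB : A ⊆ B) :
    #(prefixed A ∩ prefixed B) * (#B).choose #A ≤ #(prefixed B) := by
  refine (Nat.mul_le_mul_right _ (card_prefixed_inter_le hAB)).trans_eq ?_
  rw [card_prefixed, ← Nat.choose_mul_factorial_mul_factorial (card_le_card hAB)]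
  ring

lemma card_prefixed_inter_mul_choose_le' {A B : Finset X} (hAB : A ⊆ B) :
    #(prefixed A ∩ prefixed B) * (card X - #A).choose (#B - #A) ≤ #(prefixed A) := by
  refine (Nat.mul_le_mul_right _ (card_prefixed_inter_le hAB)).trans_eq ?_
  have h1 := card_le_card hAB
  have h2 := card_le_univ B
  rw [card_prefixed, ← Nat.choose_mul_factorial_mul_factorial
    (show #B - #A ≤ card X - #A by omega),
    show card X - #A - (#B - #A) = card X - #B by omega]
  ring

/-- A chain with more than `k` members contains many pairs at distance at least `k`. -/
lemma card_filter_isPrefix_le (F : Finset (Finset X)) {k : ℕ} (hk : 0 < k)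
    (f : Numbering X) :
    #{A ∈ F | IsPrefix f A} ≤
      k + #{p ∈ F ×ˢ F | (p.1 < p.2 ∧ #p.1 + k ≤ #p.2) ∧ IsPrefix f p.1 ∧ IsPrefix f p.2} := by
  set G := {A ∈ F | IsPrefix f A} with hG
  have hmem {A} : A ∈ G ↔ A ∈ F ∧ IsPrefix f A := by simp [hG]
  rcases G.eq_empty_or_nonempty with h | h
  · simp [h]
  obtain ⟨A, hA, hmin⟩ := exists_min_image G card h
  rw [← card_filter_add_card_filter_not (s := G) (fun B ↦ #B < #A + k)]
  refine add_le_add ?_ ?_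
  · have : #(Ico #A (#A + k)) = k := by simp
    refine (card_le_card_of_injOn card ?_ ?_).trans_eq this
    · intro B hB
      simp only [coe_filter, Set.mem_ofPred_eq] at hB
      simpa using ⟨hmin B hB.1, hB.2⟩
    · intro B hB C hC hBC
      simp only [coe_filter, Set.mem_ofPred_eq, hmem] at hB hC
      exact (hB.1.2.subset_of_card_le_card hC.1.2 hBC.le).antisymm
        (hC.1.2.subset_of_card_le_card hB.1.2 hBC.ge)
  · refine card_le_card_of_injOn (fun B ↦ (A, B)) ?_ ?_
    · intro B hB
      simp only [coe_filter, Set.mem_ofPred_eq, hmem, not_lt] at hB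
      have hA' := hmem.1 hA
      have hsub := hA'.2.subset_of_card_le_card hB.1.2 (by omega)
      simp only [coe_filter, mem_product, Set.mem_ofPred_eq]
      refine ⟨⟨hA'.1, hB.1.1⟩, ⟨hsub.ssubset_of_ne ?_, hB.2⟩, hA'.2, hB.1.2⟩
      rintro rfl
      omega
    · intro B _ C _ h
      exact (Prod.mk.inj h).2


/-- The members of a pair `A ⊂ B` at distance at least `k` are both prefixes of few numberings, as
measured by the member of the pair which is closer to the middle layer from above or below. -/
lemma choose_mul_card_prefixed_inter_le {A B : Finset X} {k : ℕ} (hAB : A ⊆ B)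
    (hk : #A + k ≤ #B) (hA : k ≤ #A) (hB : #B + k ≤ card X) :
    ((card X + 1) / 2).choose k * #(prefixed A ∩ prefixed B) ≤
      if (card X + 1) / 2 ≤ #B then #(prefixed B) else #(prefixed A) := by
  rw [mul_comm]
  split_ifs with h
  · refine le_trans (Nat.mul_le_mul_left _ ?_) (card_prefixed_inter_mul_choose_le hAB)
    exact (Nat.choose_le_choose _ h).trans (choose_le_choose_of_le_of_add_le hA hk)
  · refine le_trans (Nat.mul_le_mul_left _ ?_) (card_prefixed_inter_mul_choose_le' hAB)
    exact (Nat.choose_le_choose _ (by omega)).trans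
      (choose_le_choose_of_le_of_add_le (by omega) (by omega))

open scoped Nat in
lemma choose_mul_sum_card_prefixed_le {F : Finset (Finset X)} {k : ℕ} (hk : 0 < k)
    (hF : ∀ A ∈ F, k ≤ #A ∧ #A + k ≤ card X) :
    ((card X + 1) / 2).choose k * ∑ A ∈ F, #(prefixed A) ≤
      ((card X + 1) / 2).choose k * (k * (card X)!) +
        ∑ A ∈ F, #(nbrs F A) * #(prefixed A) := by
  classical
  set M := ((card X + 1) / 2).choose k
  let P (p : Finset X × Finset X) : Prop := p.1 < p.2 ∧ #p.1 + k ≤ #p.2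
  have hsum : ∑ A ∈ F, #(prefixed A) = ∑ f : Numbering X, #{A ∈ F | IsPrefix f A} := by
    simp only [prefixed, card_filter]
    exact sum_comm
  have hpair : ∑ f : Numbering X, #{p ∈ F ×ˢ F | P p ∧ IsPrefix f p.1 ∧ IsPrefix f p.2} =
      ∑ p ∈ F ×ˢ F with P p, #(prefixed p.1 ∩ prefixed p.2) := by
    simp only [prefixed, ← filter_and, card_filter]
    rw [sum_comm, sum_filter]
    refine sum_congr rfl fun p _ ↦ ?_
    split_ifs with h <;> simp [h]
  have h1 : ∑ A ∈ F, #(prefixed A) ≤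
      k * (card X)! + ∑ p ∈ F ×ˢ F with P p, #(prefixed p.1 ∩ prefixed p.2) := by
    rw [hsum, ← hpair]
    refine (sum_le_sum fun f _ ↦ card_filter_isPrefix_le F hk f).trans_eq ?_
    rw [sum_add_distrib, sum_const, card_univ, card_numbering, smul_eq_mul, mul_comm]
  refine (Nat.mul_le_mul_left M h1).trans ?_
  rw [mul_add]
  refine Nat.add_le_add_left ?_ _
  rw [mul_sum]
  calc ∑ p ∈ F ×ˢ F with P p, M * #(prefixed p.1 ∩ prefixed p.2)
      ≤ ∑ p ∈ F ×ˢ F with P p,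
          if (card X + 1) / 2 ≤ #p.2 then #(prefixed p.2) else #(prefixed p.1) := by
        refine sum_le_sum fun p hp ↦ ?_
        obtain ⟨hp, hlt, hle⟩ := mem_filter.1 hp
        obtain ⟨hp1, hp2⟩ := mem_product.1 hp
        exact choose_mul_card_prefixed_inter_le hlt.le hle (hF _ hp1).1 (hF _ hp2).2
    _ ≤ ∑ A ∈ F, ∑ B ∈ F,
          ((if A < B ∧ (card X + 1) / 2 ≤ #B then #(prefixed B) else 0) +
            if A < B ∧ ¬ (card X + 1) / 2 ≤ #B then #(prefixed A) else 0) := by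
        rw [sum_filter, sum_product]
        refine sum_le_sum fun A _ ↦ sum_le_sum fun B _ ↦ ?_
        by_cases h : P (A, B)
        · have h' : A < B := h.1
          by_cases h2 : (card X + 1) / 2 ≤ #B <;> simp [h, h', h2]
        · simp [h]
    _ = ∑ A ∈ F, ∑ B ∈ F,
          ((if B < A ∧ (card X + 1) / 2 ≤ #A then #(prefixed A) else 0) +
            if A < B ∧ ¬ (card X + 1) / 2 ≤ #B then #(prefixed A) else 0) := by
        simp only [sum_add_distrib]
        rw [sum_comm]
    _ ≤ ∑ A ∈ F, ∑ B ∈ F, if B < A ∨ A < B then #(prefixed A) else 0 := by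
        refine sum_le_sum fun A _ ↦ sum_le_sum fun B _ ↦ ?_
        by_cases h1 : B < A
        · have h2 : ¬ A < B := h1.asymm
          simp only [h1, h2, true_and, false_and, if_false, add_zero, true_or, if_true]
          split_ifs <;> simp
        · by_cases h2 : A < B
          · simp only [h1, h2, true_and, false_and, if_false, zero_add, or_true, if_true]
            split_ifs <;> simp
          · simp [h1, h2]
    _ = ∑ A ∈ F, #(nbrs F A) * #(prefixed A) := by
        refine sum_congr rfl fun A _ ↦ ?_
        rw [← sum_filter, sum_const, smul_eq_mul]
        congr 2
        ext B
        simp [nbrs]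

/-- Supersaturation: a family with few comparable pairs is not much larger than `k` layers. -/
lemma card_mul_sub_le {F : Finset (Finset X)} {k : ℕ} (hk : 0 < k)
    (hF : ∀ A ∈ F, k ≤ #A ∧ #A + k ≤ card X) {d : ℝ}
    (hd : d ≤ ((card X + 1) / 2).choose k) (hdeg : ∀ A ∈ F, (#(nbrs F A) : ℝ) ≤ d) :
    #F * (((card X + 1) / 2).choose k - d) ≤
      ((card X + 1) / 2).choose k * (k * (card X).choose (card X / 2)) := by
  have h := choose_mul_sum_card_prefixed_le hk hF
  set M := ((card X + 1) / 2).choose k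
  set N := (card X).choose (card X / 2)
  have h' : (M : ℝ) * ∑ A ∈ F, (#(prefixed A) : ℝ) ≤
      M * (k * (card X).factorial) + ∑ A ∈ F, (#(nbrs F A) : ℝ) * #(prefixed A) := by
    exact_mod_cast h
  have h2 : ∑ A ∈ F, (#(nbrs F A) : ℝ) * #(prefixed A) ≤ d * ∑ A ∈ F, (#(prefixed A) : ℝ) := by
    rw [mul_sum]
    exact sum_le_sum fun A hA ↦ mul_le_mul_of_nonneg_right (hdeg A hA) (Nat.cast_nonneg _)
  have h3 : (#F : ℝ) * (card X).factorial ≤ N * ∑ A ∈ F, (#(prefixed A) : ℝ) := by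
    rw [mul_sum, ← nsmul_eq_mul, ← sum_const]
    refine sum_le_sum fun A _ ↦ ?_
    rw [card_prefixed, ← Nat.choose_mul_factorial_mul_factorial (card_le_univ A), mul_assoc]
    exact_mod_cast Nat.mul_le_mul_right _ (Nat.choose_le_middle _ _)
  have hpos : (0 : ℝ) < (card X).factorial := by exact_mod_cast Nat.factorial_pos _
  refine le_of_mul_le_mul_right ?_ hpos
  calc #F * ((M : ℝ) - d) * (card X).factorial
      = #F * (card X).factorial * (M - d) := by ring
    _ ≤ N * (∑ A ∈ F, (#(prefixed A) : ℝ)) * (M - d) :=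
        mul_le_mul_of_nonneg_right h3 (sub_nonneg.2 hd)
    _ = N * (M * (∑ A ∈ F, (#(prefixed A) : ℝ)) - d * ∑ A ∈ F, (#(prefixed A) : ℝ)) := by ring
    _ ≤ N * (M * (k * (card X).factorial)) :=
        mul_le_mul_of_nonneg_left (by linarith) (Nat.cast_nonneg _)
    _ = M * (k * N) * (card X).factorial := by ring

end Supersaturation

section Counting

/-- The subsets of `Fin n` missing the two lowest and the two highest layers. -/
def innerLayers (n : ℕ) : Finset (Finset (Fin n)) := {A | 2 ≤ #A ∧ #A + 2 ≤ n}

lemma mem_innerLayers {n : ℕ} {A : Finset (Fin n)} :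
    A ∈ innerLayers n ↔ 2 ≤ #A ∧ #A + 2 ≤ n := by
  simp [innerLayers]

lemma card_univ_sdiff_innerLayers_le {n : ℕ} (hn : 1 ≤ n) :
    #(univ \ innerLayers n) ≤ 2 * n + 2 := by
  have hsub : univ \ innerLayers n ⊆
      (powersetCard 0 univ ∪ powersetCard 1 univ) ∪
        (powersetCard (n - 1) univ ∪ powersetCard n univ) := by
    intro A hA
    rw [mem_sdiff, mem_innerLayers] at hA
    have hc := card_le_univ A
    rw [Fintype.card_fin] at hc
    simp only [mem_union, mem_powersetCard_univ]
    have := hA.2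
    omega
  refine (card_le_card hsub).trans ?_
  refine (card_union_le _ _).trans
    ((add_le_add (card_union_le _ _) (card_union_le _ _)).trans ?_)
  simp only [card_powersetCard, card_univ, Fintype.card_fin, Nat.choose_zero_right,
    Nat.choose_one_right, Nat.choose_self]
  rw [Nat.choose_symm hn, Nat.choose_one_right]
  omega

lemma two_pow_le_succ_mul_choose_middle (n : ℕ) : 2 ^ n ≤ (n + 1) * n.choose (n / 2) := by
  rw [← Nat.sum_range_choose]
  refine (sum_le_sum fun i _ ↦ Nat.choose_le_middle i n).trans_eq ?_
  simp

lemma exists_mul_le_card_nbrs {n : ℕ} (hn : 1 ≤ n) {e : ℝ} (he0 : 0 ≤ e) (he1 : e ≤ 1)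
    {T : Finset (Finset (Fin n))} (hT : T ⊆ innerLayers n)
    (hcard : (1 + e) * n.choose (n / 2) < #T) : ∃ v ∈ T, e * n / 4 ≤ #(nbrs T v) := by
  by_contra! hdeg
  have hM : (n : ℝ) ≤ 2 * ((n + 1) / 2 : ℕ) := by
    exact_mod_cast (show n ≤ 2 * ((n + 1) / 2) by omega)
  have hn' : (1 : ℝ) ≤ n := by exact_mod_cast hn
  have h := card_mul_sub_le (F := T) (k := 1) one_pos (d := e * n / 4)
    (fun A hA ↦ by have := mem_innerLayers.1 (hT hA); simp only [Fintype.card_fin]; omega)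
    (by simp only [Fintype.card_fin, Nat.choose_one_right]; nlinarith)
    (fun A hA ↦ (hdeg A hA).le)
  simp only [Fintype.card_fin, Nat.choose_one_right, Nat.cast_one, one_mul] at h
  set M : ℝ := (((n + 1) / 2 : ℕ) : ℝ)
  set N : ℝ := (n.choose (n / 2) : ℝ)
  have hN : 0 ≤ N := Nat.cast_nonneg _
  have hM0 : 0 < M := by linarith
  have h1 : M * (1 - e / 2) ≤ M - e * n / 4 := by nlinarith
  have h2 : M * (#T * (1 - e / 2)) ≤ M * N := by
    calc M * (#T * (1 - e / 2)) = #T * (M * (1 - e / 2)) := by ring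
      _ ≤ #T * (M - e * n / 4) := mul_le_mul_of_nonneg_left h1 (Nat.cast_nonneg _)
      _ ≤ M * N := h
  have h3 := le_of_mul_le_mul_left h2 hM0
  have h4 : (1 + e) * N * (1 - e / 2) < #T * (1 - e / 2) :=
    mul_lt_mul_of_pos_right hcard (by linarith)
  have h5 : 0 ≤ e * (1 - e) * N := mul_nonneg (mul_nonneg he0 (by linarith)) hN
  nlinarith

lemma exists_sq_le_card_nbrs {n : ℕ} (hn : 4 ≤ n)
    {T : Finset (Finset (Fin n))} (hT : T ⊆ innerLayers n)
    (hcard : 4 * (n.choose (n / 2) : ℝ) < #T) : ∃ v ∈ T, (n : ℝ) ^ 2 / 32 ≤ #(nbrs T v) := by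
  by_contra! hdeg
  have hn' : (4 : ℝ) ≤ n := by exact_mod_cast hn
  have hM : (n : ℝ) ^ 2 / 16 ≤ (((n + 1) / 2).choose 2 : ℕ) := by
    have hq : (n : ℝ) ≤ 2 * ((n + 1) / 2 : ℕ) := by
      exact_mod_cast (show n ≤ 2 * ((n + 1) / 2) by omega)
    rw [Nat.cast_choose_two]
    nlinarith
  have h := card_mul_sub_le (F := T) (k := 2) two_pos (d := (n : ℝ) ^ 2 / 32)
    (fun A hA ↦ by simpa using mem_innerLayers.1 (hT hA))
    (by simp only [Fintype.card_fin]; nlinarith)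
    (fun A hA ↦ (hdeg A hA).le)
  simp only [Fintype.card_fin, Nat.cast_ofNat] at h
  set M : ℝ := ((((n + 1) / 2).choose 2 : ℕ) : ℝ)
  have hM0 : 0 < M := by nlinarith
  have h2 : M * #T ≤ M * (4 * n.choose (n / 2)) := by
    have : #T * (M / 2) ≤ #T * (M - (n : ℝ) ^ 2 / 32) :=
      mul_le_mul_of_nonneg_left (by linarith) (Nat.cast_nonneg _)
    linarith
  exact hcard.not_ge (le_of_mul_le_mul_left h2 hM0)

lemma exp_le_two_rpow {x : ℝ} (hx : 0 ≤ x) : Real.exp x ≤ (2 : ℝ) ^ (2 * x) := by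
  rw [Real.rpow_def_of_pos two_pos]
  refine Real.exp_le_exp.2 ?_
  nlinarith [Real.log_two_gt_d9]

lemma card_antichains_innerLayers_le {n : ℕ} (hn : 4 ≤ n) {e : ℝ} (he0 : 0 < e) (he1 : e ≤ 1)
    (hL : 1 ≤ Real.log n) (he : e ^ 2 * n = Real.log n) :
    (#(antichains (innerLayers n)) : ℝ) ≤
      (2 : ℝ) ^ ((1 + e) * n.choose (n / 2)) * Real.exp (4 * e * (4 * n.choose (n / 2))) *
        Real.exp (64 * Real.log n / n ^ 2 * #(innerLayers n)) := by
  have hn' : (4 : ℝ) ≤ n := by exact_mod_cast hn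
  have hn0 : (0 : ℝ) < n := by linarith
  refine card_antichains_le_mul_exp (m := 4 * n.choose (n / 2)) (d := (n : ℝ) ^ 2 / 32)
    (by positivity) ?_ (fun T hT ↦ exists_sq_le_card_nbrs hn hT) fun T hT hTm ↦ ?_
  · have h : 64 * Real.log n / n ^ 2 * ((n : ℝ) ^ 2 / 32) = Real.log n + Real.log n := by
      field_simp
      ring
    rw [h, Real.exp_neg, Real.exp_add, Real.exp_log hn0, inv_eq_one_div, ← sq]
    gcongr
    linarith
  · refine (card_antichains_le_mul_exp (m := (1 + e) * n.choose (n / 2)) (d := e * n / 4)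
      (t := 4 * e) (K := (2 : ℝ) ^ ((1 + e) * n.choose (n / 2))) (by positivity) ?_
      (fun S hS ↦ exists_mul_le_card_nbrs (by omega) he0.le he1 (hS.trans hT))
      fun S _ hS ↦ ?_).trans ?_
    · have h : 4 * e * (e * n / 4) = Real.log n := by rw [← he]; ring
      rw [h, Real.exp_neg, Real.exp_log hn0, inv_le_iff_one_le_mul₀ hn0]
      nlinarith
    · refine le_trans (b := (2 : ℝ) ^ (#S : ℝ)) ?_
        (Real.rpow_le_rpow_of_exponent_le one_le_two hS)
      rw [Real.rpow_natCast]
      exact_mod_cast card_antichains_le_two_pow S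
    · gcongr

end Counting

end AntichainCount

open AntichainCount in
/-- The number of antichains in the boolean lattice `P(n)` is at most
`2^{(1 + O(√(log n / n))) C(n, ⌈n/2⌉)}`. -/
theorem countAntichainsBoolean :
    ∃ C : ℝ, 0 < C ∧ ∃ n0 : ℕ, ∀ n : ℕ, n0 ≤ n →
      (Nat.card {A : Finset (Finset (Fin n)) //
          IsAntichain (· ≤ ·) (A : Set (Finset (Fin n)))} : ℝ) ≤
        (2 : ℝ) ^ ((1 + C * Real.sqrt (Real.log n / n)) *
          (Nat.choose n ((n + 1) / 2) : ℝ)) := by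
  refine ⟨305, by norm_num, 4, fun n hn ↦ ?_⟩
  have hn' : (4 : ℝ) ≤ n := by exact_mod_cast hn
  have hn0 : (0 : ℝ) < n := by linarith
  have hL : 1 ≤ Real.log n := by
    rw [Real.le_log_iff_exp_le hn0]
    linarith [Real.exp_one_lt_d9]
  have hLn : Real.log n ≤ n := (Real.log_le_sub_one_of_pos hn0).trans (by linarith)
  set L := Real.log n with hLdef
  set e := Real.sqrt (L / n)
  have hsq : e ^ 2 = L / n := Real.sq_sqrt (by positivity)
  have he : e ^ 2 * n = L := by rw [hsq]; field_simp
  have he0 : 0 < e := Real.sqrt_pos.2 (by positivity)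
  have he1 : e ≤ 1 := Real.sqrt_le_one.2 ((div_le_one hn0).2 hLn)
  have hmid : n.choose ((n + 1) / 2) = n.choose (n / 2) := by
    rw [← Nat.choose_symm (Nat.div_le_self n 2)]
    congr 1
    omega
  rw [hmid]
  have hcount : Nat.card {A : Finset (Finset (Fin n)) //
      IsAntichain (· ≤ ·) (A : Set (Finset (Fin n)))} =
      #(antichains (univ : Finset (Finset (Fin n)))) := by
    classical
    rw [Nat.card_eq_fintype_card, Fintype.card_subtype]
    congr 1
  rw [hcount]
  have h1 : (#(antichains (univ : Finset (Finset (Fin n)))) : ℝ) ≤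
      #(antichains (innerLayers n)) * (2 : ℝ) ^ (2 * n + 2 : ℝ) := by
    have h := card_antichains_le_mul_two_pow univ (innerLayers n)
    rw [univ_inter] at h
    have h' := h.trans (Nat.mul_le_mul_left _
      (Nat.pow_le_pow_right two_pos (card_univ_sdiff_innerLayers_le (n := n) (by omega))))
    have h2 : (2 : ℝ) ^ (2 * n + 2 : ℝ) = ((2 ^ (2 * n + 2) : ℕ) : ℝ) := by
      rw [show (2 * n + 2 : ℝ) = ((2 * n + 2 : ℕ) : ℝ) by push_cast; ring, Real.rpow_natCast]
      push_cast
      rfl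
    rw [h2]
    exact_mod_cast h'
  have h2 := card_antichains_innerLayers_le hn he0 he1 hL he
  set N : ℝ := (n.choose (n / 2) : ℝ) with hN
  have hN0 : 0 ≤ N := Nat.cast_nonneg _
  have hV : (#(innerLayers n) : ℝ) ≤ (n + 1) * N := by
    have h : #(innerLayers n) ≤ 2 ^ n := by
      simpa using card_le_univ (innerLayers n)
    rw [hN]
    exact_mod_cast h.trans (two_pow_le_succ_mul_choose_middle n)
  have h3 : 64 * L / n ^ 2 * #(innerLayers n) ≤ 128 * e * N := by
    calc 64 * L / n ^ 2 * #(innerLayers n) ≤ 64 * L / n ^ 2 * ((n + n) * N) := by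
          gcongr
          refine hV.trans ?_
          gcongr
          linarith
      _ = 128 * e ^ 2 * N := by
          rw [hsq]
          field_simp
          ring
      _ ≤ 128 * e * N := by
          gcongr
          nlinarith
  have h4 : (2 * n + 2 : ℝ) ≤ 16 * e * N := by
    have hNn : (n : ℝ) ^ 2 / 4 ≤ N := by
      refine le_trans (b := ((n.choose 2 : ℕ) : ℝ)) ?_
        (Nat.cast_le.2 (Nat.choose_le_middle 2 n))
      rw [Nat.cast_choose_two]
      nlinarith
    have hen : 1 ≤ e * n := by nlinarith
    nlinarith
  have h5 : Real.exp (4 * e * (4 * N)) ≤ (2 : ℝ) ^ (2 * (4 * e * (4 * N))) :=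
    exp_le_two_rpow (by positivity)
  have h6 : Real.exp (64 * L / n ^ 2 * #(innerLayers n)) ≤ (2 : ℝ) ^ (2 * (128 * e * N)) :=
    (Real.exp_le_exp.2 h3).trans (exp_le_two_rpow (by positivity))
  have h7 : (2 : ℝ) ^ (2 * n + 2 : ℝ) ≤ (2 : ℝ) ^ (16 * e * N) :=
    Real.rpow_le_rpow_of_exponent_le one_le_two h4
  calc (#(antichains (univ : Finset (Finset (Fin n)))) : ℝ)
      ≤ #(antichains (innerLayers n)) * (2 : ℝ) ^ (2 * n + 2 : ℝ) := h1
    _ ≤ (2 : ℝ) ^ ((1 + e) * N) * (2 : ℝ) ^ (2 * (4 * e * (4 * N))) *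
          (2 : ℝ) ^ (2 * (128 * e * N)) * (2 : ℝ) ^ (16 * e * N) := by
        refine mul_le_mul (h2.trans ?_) h7 (by positivity) (by positivity)
        gcongr
    _ = (2 : ℝ) ^ ((1 + 305 * e) * N) := by
        rw [← Real.rpow_add two_pos, ← Real.rpow_add two_pos, ← Real.rpow_add two_pos]
        congr 1
        ring
end

section
/- Let q be a fixed prime power and let ε > 0. There exists a constant c(ε,q) > 0 such that for every δ > 0 there exists n0 with the following property: for every n ≥ n0 and every p with c(ε,q)/q^{n/2} ≤ p ≤ 1, if A is a random subset of V(q,n) in which each subspace is included independently with probability p (i.e., A is distributed according to the product over V(q,n) of Bernoulli(p) distributions), then with probability at least 1 − δ every antichain contained in A has cardinality at most (1+ε)·p·[n choose ⌊n/2⌋]_q. -/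
open MeasureTheory ProbabilityTheory

/-- The Gaussian binomial coefficient `[n choose i]_q`, realized as the number of
`i`-dimensional linear subspaces of `F^n`, where `F` is a field (of cardinality `q`). -/
noncomputable def gaussBinom (F : Type*) [Field F] (n i : ℕ) : ℕ :=
  Nat.card {W : Submodule F (Fin n → F) // Module.finrank F W = i}

open Module in
theorem card_submodule_finrank_mul_prod {F V : Type*} [Field F] [Fintype F] [AddCommGroup V]
    [Module F V] [Finite V] {k : ℕ} (hk : k ≤ finrank F V) :
    Nat.card {W : Submodule F V // finrank F W = k} *
        ∏ i : Fin k, (Fintype.card F ^ k - Fintype.card F ^ (i : ℕ)) =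
      ∏ i : Fin k, (Fintype.card F ^ finrank F V - Fintype.card F ^ (i : ℕ)) := by
  have := Fintype.ofFinite {W : Submodule F V // finrank F W = k}
  let f : (Σ W : {W : Submodule F V // finrank F W = k},
      {s : Fin k → W.1 // LinearIndependent F s}) → {s : Fin k → V // LinearIndependent F s} :=
    fun s => ⟨fun i => s.2.1 i, s.2.2.map' (Submodule.subtype _) (by simp)⟩
  have hspan (W : Submodule F V) (hW : finrank F W = k) (s : Fin k → W)
      (hs : LinearIndependent F s) : Submodule.span F (Set.range fun i => (s i : V)) = W := by
    refine Submodule.eq_of_le_of_finrank_eq ?_ ?_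
    · rw [Submodule.span_le]
      rintro _ ⟨i, rfl⟩
      exact (s i).2
    · have h := finrank_span_eq_card (hs.map' (Submodule.subtype _) (by simp))
      rw [Fintype.card_fin] at h
      rw [hW]; exact h
  have hf : Function.Bijective f := by
    constructor
    · rintro ⟨⟨W, hW⟩, s, hs⟩ ⟨⟨W', hW'⟩, s', hs'⟩ h
      have hv : (fun i => (s i : V)) = fun i => (s' i : V) := congrArg Subtype.val h
      obtain rfl : W = W' := by rw [← hspan W hW s hs, ← hspan W' hW' s' hs', hv]
      obtain rfl : s = s' := funext fun i => Subtype.ext (congrFun hv i)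
      rfl
    · rintro ⟨s, hs⟩
      exact ⟨⟨⟨Submodule.span F (Set.range s), by rw [finrank_span_eq_card hs, Fintype.card_fin]⟩,
        fun i => ⟨s i, Submodule.subset_span ⟨i, rfl⟩⟩,
        LinearIndependent.of_comp (Submodule.subtype _) hs⟩, rfl⟩
  rw [← card_linearIndependent hk, ← Nat.card_congr (Equiv.ofBijective f hf), Nat.card_sigma]
  have h (W : {W : Submodule F V // finrank F W = k}) :
      Nat.card {s : Fin k → W.1 // LinearIndependent F s} =
        ∏ i : Fin k, (Fintype.card F ^ k - Fintype.card F ^ (i : ℕ)) := by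
    rw [card_linearIndependent W.2.ge, W.2]
  simp only [h]
  simp [Nat.card_eq_fintype_card]

open Module in
theorem pow_le_card_submodule_finrank {F V : Type*} [Field F] [Fintype F] [AddCommGroup V]
    [Module F V] [Finite V] {k : ℕ} (hk : k ≤ finrank F V) :
    Fintype.card F ^ (k * (finrank F V - k)) ≤
      Nat.card {W : Submodule F V // finrank F W = k} := by
  have hq : 1 < Fintype.card F := Fintype.one_lt_card
  have hpos : 0 < ∏ i : Fin k, (Fintype.card F ^ k - Fintype.card F ^ (i : ℕ)) :=
    Finset.prod_pos fun i _ => Nat.sub_pos_of_lt (Nat.pow_lt_pow_right hq i.2)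
  refine Nat.le_of_mul_le_mul_right ?_ hpos
  rw [card_submodule_finrank_mul_prod hk, mul_comm k, pow_mul]
  have : (Fintype.card F ^ (finrank F V - k)) ^ k =
      ∏ _i : Fin k, Fintype.card F ^ (finrank F V - k) := by simp
  rw [this, ← Finset.prod_mul_distrib]
  refine Finset.prod_le_prod' fun i _ => ?_
  rw [Nat.mul_sub, ← pow_add, Nat.sub_add_cancel hk]
  exact Nat.sub_le_sub_left (Nat.le_mul_of_pos_left _ (by positivity)) _

theorem gaussBinom_succ_mul {F : Type*} [Field F] [Fintype F] {n k : ℕ} (hk : k + 1 ≤ n) :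
    gaussBinom F n (k + 1) * (Fintype.card F ^ (k + 1) - 1) =
      gaussBinom F n k * (Fintype.card F ^ (n - k) - 1) := by
  have hq : 1 < Fintype.card F := Fintype.one_lt_card
  have h0 := card_submodule_finrank_mul_prod (F := F) (V := Fin n → F) (k := k)
    (by simp; omega)
  have h1 := card_submodule_finrank_mul_prod (F := F) (V := Fin n → F) (k := k + 1)
    (by simp; omega)
  rw [Module.finrank_fin_fun] at h0 h1
  rw [Fin.prod_univ_castSucc (n := k) (fun i => Fintype.card F ^ n - _)] at h1
  rw [Fin.prod_univ_succ] at h1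
  simp only [Fin.val_castSucc, Fin.val_last, Fin.val_succ, Fin.val_zero, pow_zero] at h1
  rw [← h0] at h1
  have hs : ∏ i : Fin k, (Fintype.card F ^ (k + 1) - Fintype.card F ^ ((i : ℕ) + 1)) =
      Fintype.card F ^ k * ∏ i : Fin k, (Fintype.card F ^ k - Fintype.card F ^ (i : ℕ)) := by
    have : Fintype.card F ^ k = ∏ _i : Fin k, Fintype.card F := by simp
    rw [this, ← Finset.prod_mul_distrib, ← this]
    refine Finset.prod_congr rfl fun i _ => ?_
    rw [Nat.mul_sub, pow_succ', pow_succ']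
  rw [hs] at h1
  have hpos : 0 < ∏ i : Fin k, (Fintype.card F ^ k - Fintype.card F ^ (i : ℕ)) :=
    Finset.prod_pos fun i _ => Nat.sub_pos_of_lt (Nat.pow_lt_pow_right hq i.2)
  have hfac : Fintype.card F ^ n - Fintype.card F ^ k =
      Fintype.card F ^ k * (Fintype.card F ^ (n - k) - 1) := by
    rw [Nat.mul_sub, ← pow_add, mul_one]; congr 2; omega
  rw [hfac] at h1
  unfold gaussBinom
  have hqk : 0 < Fintype.card F ^ k := by positivity
  refine Nat.eq_of_mul_eq_mul_right (Nat.mul_pos hqk hpos) ?_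
  linear_combination h1

theorem pow_le_gaussBinom {F : Type*} [Field F] [Fintype F] {n k : ℕ} (hk : k ≤ n) :
    Fintype.card F ^ (k * (n - k)) ≤ gaussBinom F n k := by
  have h := pow_le_card_submodule_finrank (F := F) (V := Fin n → F) (k := k) (by simpa)
  rwa [Module.finrank_fin_fun] at h

theorem two_mul_gaussBinom_le_succ {F : Type*} [Field F] [Fintype F] {n k : ℕ}
    (hk : 2 * k + 2 ≤ n) : 2 * gaussBinom F n k ≤ gaussBinom F n (k + 1) := by
  have hq : 2 ≤ Fintype.card F := Fintype.one_lt_card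
  have h := gaussBinom_succ_mul (F := F) (n := n) (k := k) (by omega)
  have h1 : 2 ≤ Fintype.card F ^ (k + 1) := hq.trans (Nat.le_self_pow (by omega) _)
  have h2 : 2 * (Fintype.card F ^ (k + 1) - 1) ≤ Fintype.card F ^ (n - k) - 1 := by
    have : Fintype.card F ^ (k + 2) ≤ Fintype.card F ^ (n - k) :=
      Nat.pow_le_pow_right (by omega) (by omega)
    have h3 : Fintype.card F ^ (k + 2) = Fintype.card F ^ (k + 1) * Fintype.card F := pow_succ _ _
    have : Fintype.card F ^ (k + 1) * 2 ≤ Fintype.card F ^ (k + 1) * Fintype.card F := by gcongr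
    omega
  refine Nat.le_of_mul_le_mul_right (c := Fintype.card F ^ (k + 1) - 1) ?_ (by omega)
  rw [h]
  calc _ = gaussBinom F n k * (2 * (Fintype.card F ^ (k + 1) - 1)) := by ring
    _ ≤ _ := by gcongr

theorem gaussBinom_succ_le {F : Type*} [Field F] [Fintype F] {n k : ℕ}
    (hk : n ≤ 2 * k + 1) (hkn : k + 1 ≤ n) : gaussBinom F n (k + 1) ≤ gaussBinom F n k := by
  have hq : 2 ≤ Fintype.card F := Fintype.one_lt_card
  have h := gaussBinom_succ_mul (F := F) (n := n) (k := k) (by omega)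
  have h1 : 2 ≤ Fintype.card F ^ (k + 1) := hq.trans (Nat.le_self_pow (by omega) _)
  have h2 : Fintype.card F ^ (n - k) ≤ Fintype.card F ^ (k + 1) :=
    Nat.pow_le_pow_right (by omega) (by omega)
  refine Nat.le_of_mul_le_mul_right (c := Fintype.card F ^ (k + 1) - 1) ?_ (by omega)
  rw [h]
  gcongr

theorem two_mul_gaussBinom_succ_le {F : Type*} [Field F] [Fintype F] {n k : ℕ}
    (hk : n ≤ 2 * k) (hkn : k + 1 ≤ n) : 2 * gaussBinom F n (k + 1) ≤ gaussBinom F n k := by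
  have hq : 2 ≤ Fintype.card F := Fintype.one_lt_card
  have h := gaussBinom_succ_mul (F := F) (n := n) (k := k) (by omega)
  have h1 : 2 ≤ Fintype.card F ^ (n - k) := hq.trans (Nat.le_self_pow (by omega) _)
  have h2 : 2 * (Fintype.card F ^ (n - k) - 1) ≤ Fintype.card F ^ (k + 1) - 1 := by
    have : Fintype.card F ^ (n - k + 1) ≤ Fintype.card F ^ (k + 1) :=
      Nat.pow_le_pow_right (by omega) (by omega)
    have h3 : Fintype.card F ^ (n - k + 1) = Fintype.card F ^ (n - k) * Fintype.card F :=
      pow_succ _ _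
    have : Fintype.card F ^ (n - k) * 2 ≤ Fintype.card F ^ (n - k) * Fintype.card F := by gcongr
    omega
  refine Nat.le_of_mul_le_mul_right (c := Fintype.card F ^ (k + 1) - 1) ?_ (by omega)
  rw [mul_assoc, h]
  calc _ = gaussBinom F n k * (2 * (Fintype.card F ^ (n - k) - 1)) := by ring
    _ ≤ _ := by gcongr

/-- Below the middle, layer sizes at least halve at each step away from it. -/
theorem two_pow_mul_gaussBinom_sub_le {F : Type*} [Field F] [Fintype F] {n j : ℕ}
    (hj : j ≤ n / 2) : 2 ^ j * gaussBinom F n (n / 2 - j) ≤ gaussBinom F n (n / 2) := by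
  induction j with
  | zero => simp
  | succ j ih =>
    refine le_trans ?_ (ih (by omega))
    have h := two_mul_gaussBinom_le_succ (F := F) (n := n) (k := n / 2 - (j + 1)) (by omega)
    rw [show n / 2 - (j + 1) + 1 = n / 2 - j by omega] at h
    rw [pow_succ, mul_assoc]
    gcongr

theorem two_pow_mul_gaussBinom_add_le {F : Type*} [Field F] [Fintype F] {n j : ℕ}
    (hj : n / 2 + (j + 1) ≤ n) :
    2 ^ j * gaussBinom F n (n / 2 + (j + 1)) ≤ gaussBinom F n (n / 2) := by
  induction j with
  | zero => simpa using gaussBinom_succ_le (F := F) (n := n) (k := n / 2) (by omega) (by omega)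
  | succ j ih =>
    refine le_trans ?_ (ih (by omega))
    have h := two_mul_gaussBinom_succ_le (F := F) (n := n) (k := n / 2 + (j + 1)) (by omega)
      (by omega)
    rw [pow_succ, mul_assoc]
    gcongr
    exact h

theorem gaussBinom_eq_zero {F : Type*} [Field F] {n k : ℕ} (hk : n < k) :
    gaussBinom F n k = 0 := by
  have : IsEmpty {W : Submodule F (Fin n → F) // Module.finrank F W = k} :=
    ⟨fun W => by
      have := W.1.finrank_le
      rw [W.2, Module.finrank_fin_fun] at this
      omega⟩
  simp [gaussBinom]

theorem gaussBinom_le_half {F : Type*} [Field F] [Fintype F] (n k : ℕ) :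
    gaussBinom F n k ≤ gaussBinom F n (n / 2) := by
  rcases le_or_gt k (n / 2) with h | h
  · have := two_pow_mul_gaussBinom_sub_le (F := F) (n := n) (j := n / 2 - k) (by omega)
    rw [show n / 2 - (n / 2 - k) = k by omega] at this
    exact (Nat.le_mul_of_pos_left _ (by positivity)).trans this
  · rcases le_or_gt k n with h' | h'
    · have := two_pow_mul_gaussBinom_add_le (F := F) (n := n) (j := k - n / 2 - 1) (by omega)
      rw [show n / 2 + (k - n / 2 - 1 + 1) = k by omega] at this
      exact (Nat.le_mul_of_pos_left _ (by positivity)).trans this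
    · rw [gaussBinom_eq_zero h']
      exact Nat.zero_le _

/-- Layers at distance at most `r` from the middle are smaller by at most a constant factor. -/
theorem gaussBinom_half_le_sub {F : Type*} [Field F] [Fintype F] {n r j : ℕ} (hj : j ≤ r)
    (hjn : j ≤ n / 2) : gaussBinom F n (n / 2) ≤
      Fintype.card F ^ ((2 * r + 2) * j) * gaussBinom F n (n / 2 - j) := by
  have hq : 2 ≤ Fintype.card F := Fintype.one_lt_card
  induction j with
  | zero => simp
  | succ j ih =>
    refine (ih (by omega) (by omega)).trans ?_
    set k := n / 2 - (j + 1) with hk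
    have h := gaussBinom_succ_mul (F := F) (n := n) (k := k) (by omega)
    rw [show n / 2 - j = k + 1 by omega, Nat.mul_succ, pow_add, mul_assoc]
    gcongr
    refine Nat.le_of_mul_le_mul_right (c := Fintype.card F ^ (k + 1) - 1) ?_
      (Nat.sub_pos_of_lt (Nat.one_lt_pow (by omega) (by omega)))
    rw [h, mul_comm (_ ^ _) (gaussBinom _ _ _), mul_assoc]
    gcongr
    have h1 : Fintype.card F ^ k ≤ Fintype.card F ^ (k + 1) - 1 := by
      have : Fintype.card F ^ k * 2 ≤ Fintype.card F ^ (k + 1) := by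
        rw [pow_succ]; gcongr
      have : 0 < Fintype.card F ^ k := by positivity
      omega
    calc Fintype.card F ^ (n - k) - 1 ≤ Fintype.card F ^ ((2 * r + 2) + k) :=
          (Nat.sub_le _ _).trans (Nat.pow_le_pow_right (by omega) (by omega))
      _ = Fintype.card F ^ (2 * r + 2) * Fintype.card F ^ k := pow_add _ _ _
      _ ≤ _ := by gcongr

theorem gaussBinom_half_le_add {F : Type*} [Field F] [Fintype F] {n r j : ℕ} (hj : j ≤ r)
    (hjn : n / 2 + j ≤ n) : gaussBinom F n (n / 2) ≤
      Fintype.card F ^ ((2 * r + 2) * j) * gaussBinom F n (n / 2 + j) := by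
  have hq : 2 ≤ Fintype.card F := Fintype.one_lt_card
  induction j with
  | zero => simp
  | succ j ih =>
    refine (ih (by omega) (by omega)).trans ?_
    set k := n / 2 + j with hk
    have h := gaussBinom_succ_mul (F := F) (n := n) (k := k) (by omega)
    rw [← add_assoc, ← hk, Nat.mul_succ, pow_add, mul_assoc]
    gcongr
    refine Nat.le_of_mul_le_mul_right (c := Fintype.card F ^ (n - k) - 1) ?_
      (Nat.sub_pos_of_lt (Nat.one_lt_pow (by omega) (by omega)))
    rw [← h, mul_comm (_ ^ _) (gaussBinom _ _ _), mul_assoc]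
    gcongr
    have h1 : Fintype.card F ^ (n - k - 1) ≤ Fintype.card F ^ (n - k) - 1 := by
      have : Fintype.card F ^ (n - k - 1) * 2 ≤ Fintype.card F ^ (n - k) := by
        conv_rhs => rw [show n - k = n - k - 1 + 1 by omega, pow_succ]
        gcongr
      have : 0 < Fintype.card F ^ (n - k - 1) := by positivity
      omega
    calc Fintype.card F ^ (k + 1) - 1 ≤ Fintype.card F ^ ((2 * r + 2) + (n - k - 1)) :=
          (Nat.sub_le _ _).trans (Nat.pow_le_pow_right (by omega) (by omega))
      _ = Fintype.card F ^ (2 * r + 2) * Fintype.card F ^ (n - k - 1) := pow_add _ _ _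
      _ ≤ _ := by gcongr

theorem gaussBinom_half_le {F : Type*} [Field F] [Fintype F] {n r k : ℕ} (hr : r ≤ n / 2)
    (h1 : n / 2 ≤ k + r) (h2 : k ≤ n / 2 + r) : gaussBinom F n (n / 2) ≤
      Fintype.card F ^ ((2 * r + 2) * r) * gaussBinom F n k := by
  have hq : 2 ≤ Fintype.card F := Fintype.one_lt_card
  rcases le_total k (n / 2) with h | h
  · obtain ⟨j, rfl⟩ : ∃ j, k = n / 2 - j := ⟨n / 2 - k, by omega⟩
    by_cases hj : j ≤ n / 2
    · refine (gaussBinom_half_le_sub (F := F) (r := r) (j := j) (by omega) hj).trans ?_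
      have : j ≤ r := by omega
      gcongr
      omega
    · have : n / 2 - j = n / 2 - n / 2 := by omega
      rw [this] at h1 ⊢
      refine (gaussBinom_half_le_sub (F := F) (r := r) (j := n / 2) (by omega) le_rfl).trans ?_
      gcongr <;> omega
  · obtain ⟨j, rfl⟩ : ∃ j, k = n / 2 + j := ⟨k - n / 2, by omega⟩
    refine (gaussBinom_half_le_add (F := F) (r := r) (j := j) (by omega) (by omega)).trans ?_
    have : j ≤ r := by omega
    gcongr
    omega

open Module in
theorem exists_linearEquiv_extending {F V V' : Type*} [Field F] [AddCommGroup V] [Module F V]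
    [AddCommGroup V'] [Module F V'] [FiniteDimensional F V] [FiniteDimensional F V']
    (hV : finrank F V = finrank F V') {U : Submodule F V} {U' : Submodule F V'}
    (e : U ≃ₗ[F] U') : ∃ h : V ≃ₗ[F] V', ∀ u : U, h u = e u := by
  obtain ⟨C, hC⟩ := U.exists_isCompl
  obtain ⟨C', hC'⟩ := U'.exists_isCompl
  have h1 := Submodule.finrank_add_eq_of_isCompl hC
  have h2 := Submodule.finrank_add_eq_of_isCompl hC'
  have h3 := e.finrank_eq
  have ec : C ≃ₗ[F] C' := LinearEquiv.ofFinrankEq _ _ (by omega)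
  refine ⟨(Submodule.prodEquivOfIsCompl U C hC).symm ≪≫ₗ (e.prodCongr ec) ≪≫ₗ
    Submodule.prodEquivOfIsCompl U' C' hC', fun u => ?_⟩
  simp

open Module in
theorem exists_linearEquiv_map_flag {F V : Type*} [Field F] [AddCommGroup V] [Module F V]
    [FiniteDimensional F V] {U W U' W' : Submodule F V} (hUW : U ≤ W) (hUW' : U' ≤ W')
    (hU : finrank F U = finrank F U') (hW : finrank F W = finrank F W') :
    ∃ h : V ≃ₗ[F] V, U.map (h : V →ₗ[F] V) = U' ∧ W.map (h : V →ₗ[F] V) = W' := by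
  have e : (U.submoduleOf W) ≃ₗ[F] (U'.submoduleOf W') :=
    (Submodule.submoduleOfEquivOfLe hUW) ≪≫ₗ (LinearEquiv.ofFinrankEq U U' hU) ≪≫ₗ
      (Submodule.submoduleOfEquivOfLe hUW').symm
  obtain ⟨f, hf⟩ := exists_linearEquiv_extending hW e
  obtain ⟨h, hh⟩ := exists_linearEquiv_extending rfl f
  have hfr (X : Submodule F V) : finrank F (X.map (h : V →ₗ[F] V)) = finrank F X :=
    LinearEquiv.finrank_map_eq h X
  refine ⟨h, ?_, ?_⟩
  · refine Submodule.eq_of_le_of_finrank_eq ?_ (by rw [hfr, hU])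
    rintro _ ⟨u, hu, rfl⟩
    have h1 := hh ⟨u, hUW hu⟩
    have h2 := hf ⟨⟨u, hUW hu⟩, hu⟩
    simp only at h1 h2
    rw [LinearEquiv.coe_coe, h1, h2]
    exact (e ⟨⟨u, hUW hu⟩, hu⟩).2
  · refine Submodule.eq_of_le_of_finrank_eq ?_ (by rw [hfr, hW])
    rintro _ ⟨u, hu, rfl⟩
    have h1 := hh ⟨u, hu⟩
    simp only at h1
    rw [LinearEquiv.coe_coe, h1]
    exact (f ⟨u, hu⟩).2

theorem exists_complete_flag (F : Type*) [Field F] (n : ℕ) :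
    ∃ E : ℕ → Submodule F (Fin n → F), Monotone E ∧ ∀ i ≤ n, Module.finrank F (E i) = i := by
  let b := Pi.basisFun F (Fin n)
  refine ⟨fun i => Submodule.span F (b '' {j | (j : ℕ) < i}), fun i j hij => ?_, fun i hi => ?_⟩
  · exact Submodule.span_mono (Set.image_mono fun k hk => lt_of_lt_of_le hk hij)
  · have : b '' {j | (j : ℕ) < i} = Set.range (fun j : Fin i => b (Fin.castLE hi j)) := by
      ext v
      constructor
      · rintro ⟨j, hj, rfl⟩
        exact ⟨⟨j, hj⟩, rfl⟩
      · rintro ⟨j, rfl⟩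
        exact ⟨Fin.castLE hi j, j.2, rfl⟩
    change Module.finrank F (Submodule.span F _) = i
    rw [this, finrank_span_eq_card, Fintype.card_fin]
    exact b.linearIndependent.comp _ (Fin.castLE_injective hi)

theorem gaussBinom_eq_card_filter {F : Type*} [Field F] {n : ℕ}
    [Fintype (Submodule F (Fin n → F))] (k : ℕ) :
    gaussBinom F n k =
      (Finset.univ.filter fun W : Submodule F (Fin n → F) => Module.finrank F W = k).card := by
  rw [gaussBinom, Nat.card_eq_fintype_card, Fintype.card_subtype]

section Flags

open scoped Classical

variable {F : Type*} [Field F] {n : ℕ}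

section

variable [Fintype ((Fin n → F) ≃ₗ[F] (Fin n → F))]

/-- The number of linear automorphisms carrying `D` to `U` and `E` to `W`. -/
noncomputable def flagCount (D E U W : Submodule F (Fin n → F)) : ℕ :=
  (Finset.univ.filter fun g : (Fin n → F) ≃ₗ[F] (Fin n → F) =>
    D.map (g : (Fin n → F) →ₗ[F] (Fin n → F)) = U ∧
      E.map (g : (Fin n → F) →ₗ[F] (Fin n → F)) = W).card

theorem flagCount_eq {D E U W U' W' : Submodule F (Fin n → F)} (hUW : U ≤ W) (hUW' : U' ≤ W')
    (hU : Module.finrank F U = Module.finrank F U')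
    (hW : Module.finrank F W = Module.finrank F W') :
    flagCount D E U W = flagCount D E U' W' := by
  obtain ⟨h, h1, h2⟩ := exists_linearEquiv_map_flag hUW hUW' hU hW
  have key (g : (Fin n → F) ≃ₗ[F] (Fin n → F)) (X Y Y' : Submodule F (Fin n → F))
      (hY : Y.map (h : (Fin n → F) →ₗ[F] (Fin n → F)) = Y') :
      X.map ((g.trans h : (Fin n → F) ≃ₗ[F] (Fin n → F)) : (Fin n → F) →ₗ[F] (Fin n → F)) = Y' ↔
        X.map (g : (Fin n → F) →ₗ[F] (Fin n → F)) = Y := by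
    rw [LinearEquiv.coe_trans, Submodule.map_comp, ← hY]
    exact (Submodule.map_injective_of_injective h.injective).eq_iff
  unfold flagCount
  refine Finset.card_bij (fun g _ => g.trans h) (fun g hg => ?_) (fun g _ g' _ hgg' => ?_)
    (fun g hg => ?_)
  · simp only [Finset.mem_filter, Finset.mem_univ, true_and] at hg ⊢
    rwa [key g D U U' h1, key g E W W' h2]
  · ext1 x
    exact h.injective (LinearEquiv.congr_fun hgg' x)
  · have hg' : (g.trans h.symm).trans h = g := by ext1 x; simp
    refine ⟨g.trans h.symm, ?_, hg'⟩
    simp only [Finset.mem_filter, Finset.mem_univ, true_and] at hg ⊢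
    rw [← key _ D U U' h1, ← key _ E W W' h2, hg']
    exact hg

end

variable [Fintype (Submodule F (Fin n → F))]

section

variable [Fintype ((Fin n → F) ≃ₗ[F] (Fin n → F))]

theorem card_eq_flagCount_self_mul {E U : Submodule F (Fin n → F)}
    (hU : Module.finrank F U = Module.finrank F E) :
    Fintype.card ((Fin n → F) ≃ₗ[F] (Fin n → F)) =
      flagCount E E U U * gaussBinom F n (Module.finrank F U) := by
  have hmap : ∀ g ∈ (Finset.univ : Finset ((Fin n → F) ≃ₗ[F] (Fin n → F))),
      E.map (g : (Fin n → F) →ₗ[F] (Fin n → F)) ∈ Finset.univ.filter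
        fun W : Submodule F (Fin n → F) => Module.finrank F W = Module.finrank F U := by
    intro g _
    rw [hU]
    simpa using LinearEquiv.finrank_map_eq g E
  rw [← Finset.card_univ, Finset.card_eq_sum_card_fiberwise hmap, gaussBinom_eq_card_filter,
    mul_comm, ← smul_eq_mul, ← Finset.sum_const]
  refine Finset.sum_congr rfl fun W hW => ?_
  rw [Finset.mem_filter] at hW
  rw [flagCount_eq (le_refl U) (le_refl W) hW.2.symm hW.2.symm]
  simp [flagCount]

end

variable [Fintype F]

theorem pow_le_card_filter_le {W : Submodule F (Fin n → F)} {a : ℕ} (ha : 1 ≤ a)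
    (haW : a < Module.finrank F W) :
    Fintype.card F ^ (Module.finrank F W - 1) ≤
      (Finset.univ.filter fun U : Submodule F (Fin n → F) =>
        Module.finrank F U = a ∧ U ≤ W).card := by
  have := Fintype.ofFinite (Submodule F W)
  have h := pow_le_card_submodule_finrank (F := F) (V := W) (k := a) haW.le
  rw [Nat.card_eq_fintype_card, Fintype.card_subtype] at h
  calc Fintype.card F ^ (Module.finrank F W - 1)
      ≤ Fintype.card F ^ (a * (Module.finrank F W - a)) := by
        refine Nat.pow_le_pow_right Fintype.card_pos ?_
        obtain ⟨k, hk⟩ := Nat.exists_eq_add_of_lt haW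
        rw [hk, show a + k + 1 - 1 = a + k by omega, show a + k + 1 - a = k + 1 by omega]
        nlinarith
    _ ≤ _ := h
    _ ≤ _ := by
        refine Finset.card_le_card_of_injOn (Submodule.map W.subtype) (fun U hU => ?_)
          (Set.injOn_of_injective (Submodule.map_injective_of_injective W.injective_subtype))
        simp only [Finset.coe_filter, Finset.mem_univ, true_and, Set.mem_ofPred_eq] at hU ⊢
        exact ⟨by rw [← hU]; exact Submodule.finrank_map_subtype_eq W U,
          Submodule.map_subtype_le W U⟩

section

variable [Fintype ((Fin n → F) ≃ₗ[F] (Fin n → F))]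

theorem flagCount_mul_le {D E U W : Submodule F (Fin n → F)} (hUW : U < W)
    (hU1 : 1 ≤ Module.finrank F U) :
    flagCount D E U W * (gaussBinom F n (Module.finrank F W) *
      Fintype.card F ^ (Module.finrank F W - 1)) ≤
        Fintype.card ((Fin n → F) ≃ₗ[F] (Fin n → F)) := by
  set T : Finset (Submodule F (Fin n → F) × Submodule F (Fin n → F)) :=
    Finset.univ.filter fun P => (Module.finrank F P.2 = Module.finrank F W) ∧
      Module.finrank F P.1 = Module.finrank F U ∧ P.1 ≤ P.2 with hT
  have hTcard : gaussBinom F n (Module.finrank F W) *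
      Fintype.card F ^ (Module.finrank F W - 1) ≤ T.card := by
    have hmap : ∀ P ∈ T, P.2 ∈ Finset.univ.filter
        fun W' : Submodule F (Fin n → F) => Module.finrank F W' = Module.finrank F W := by
      intro P hP
      simp only [hT, Finset.mem_filter, Finset.mem_univ, true_and] at hP ⊢
      exact hP.1
    rw [Finset.card_eq_sum_card_fiberwise hmap, gaussBinom_eq_card_filter, ← smul_eq_mul,
      ← Finset.sum_const]
    refine Finset.sum_le_sum fun W' hW' => ?_
    simp only [Finset.mem_filter, Finset.mem_univ, true_and] at hW'
    rw [← hW']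
    refine (pow_le_card_filter_le hU1 (hW' ▸ Submodule.finrank_lt_finrank_of_lt hUW)).trans ?_
    refine Finset.card_le_card_of_injOn (fun U' => (U', W')) (fun U' hU' => ?_)
      (fun x _ y _ h => congrArg Prod.fst h)
    simp only [Finset.coe_filter, Finset.mem_univ, true_and, Set.mem_ofPred_eq, hT,
      Finset.mem_filter] at hU' ⊢
    exact ⟨⟨hW', hU'⟩, trivial⟩
  refine (Nat.mul_le_mul_left _ hTcard).trans ?_
  rw [mul_comm, ← smul_eq_mul, ← Finset.sum_const, ← Finset.card_univ]
  calc ∑ _P ∈ T, flagCount D E U W = ∑ P ∈ T, flagCount D E P.1 P.2 := by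
        refine Finset.sum_congr rfl fun P hP => ?_
        simp only [hT, Finset.mem_filter, Finset.mem_univ, true_and] at hP
        exact flagCount_eq hUW.le hP.2.2 hP.2.1.symm hP.1.symm
    _ ≤ ∑ P : Submodule F (Fin n → F) × Submodule F (Fin n → F), flagCount D E P.1 P.2 :=
        Finset.sum_le_univ_sum_of_nonneg fun _ => Nat.zero_le _
    _ = _ := by
        rw [Finset.card_eq_sum_card_fiberwise (t := Finset.univ)
          (f := fun g : (Fin n → F) ≃ₗ[F] (Fin n → F) =>
            (D.map (g : (Fin n → F) →ₗ[F] (Fin n → F)), E.map (g : (Fin n → F) →ₗ[F] (Fin n → F))))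
          (fun _ _ => Finset.mem_coe.2 (Finset.mem_univ _))]
        refine Finset.sum_congr rfl fun P _ => ?_
        unfold flagCount
        congr 1
        ext g
        simp [Prod.ext_iff]

/-- A family of subspaces exceeding the middle layer contains many comparable pairs. -/
theorem mul_card_le_of_pairs {𝓕 : Finset (Submodule F (Fin n → F))} {B C : ℕ}
    (h1 : ∀ U ∈ 𝓕, 1 ≤ Module.finrank F U)
    (hB : ∀ W ∈ 𝓕, B ≤ C * (gaussBinom F n (Module.finrank F W) *
      Fintype.card F ^ (Module.finrank F W - 1))) :
    B * 𝓕.card ≤ gaussBinom F n (n / 2) *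
      (B + C * ((𝓕 ×ˢ 𝓕).filter fun P => P.1 < P.2).card) := by
  obtain ⟨E, hEmono, hE⟩ := exists_complete_flag F n
  have hE' (U : Submodule F (Fin n → F)) :
      Module.finrank F (E (Module.finrank F U)) = Module.finrank F U :=
    hE _ (by simpa using U.finrank_le)
  set N := Fintype.card ((Fin n → F) ≃ₗ[F] (Fin n → F)) with hN
  have hNpos : 0 < N := Fintype.card_pos
  set M := gaussBinom F n (n / 2)
  set T := (𝓕 ×ˢ 𝓕).filter fun P => P.1 < P.2 with hT
  let R (g : (Fin n → F) ≃ₗ[F] (Fin n → F)) (U : Submodule F (Fin n → F)) : Prop :=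
    (E (Module.finrank F U)).map (g : (Fin n → F) →ₗ[F] (Fin n → F)) = U
  have hchain (g : (Fin n → F) ≃ₗ[F] (Fin n → F)) :
      (𝓕.filter (R g)).card ≤ 1 + (T.filter fun P => R g P.1 ∧ R g P.2).card := by
    rcases (𝓕.filter (R g)).eq_empty_or_nonempty with h | h
    · simp [h]
    · obtain ⟨U, hU, hmin⟩ := Finset.exists_min_image _
        (fun U : Submodule F (Fin n → F) => Module.finrank F U) h
      have : (𝓕.filter (R g)).card = 1 + ((𝓕.filter (R g)).erase U).card := by
        rw [add_comm, Finset.card_erase_add_one hU]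
      rw [this]
      gcongr
      refine Finset.card_le_card_of_injOn (fun W => (U, W)) (fun W hW => ?_)
        (fun x _ y _ h => congrArg Prod.snd h)
      rw [Finset.mem_coe, Finset.mem_erase] at hW
      have hle := hmin W hW.2
      rw [Finset.mem_filter] at hU hW
      simp only [Finset.coe_filter, Set.mem_ofPred_eq, hT, Finset.mem_filter, Finset.mem_product]
      refine ⟨⟨⟨hU.1, hW.2.1⟩, lt_of_le_of_ne ?_ hW.1.symm⟩, hU.2, hW.2.2⟩
      rw [← hU.2, ← hW.2.2]
      exact Submodule.map_mono (hEmono hle)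
  have hsum : ∑ U ∈ 𝓕, (Finset.univ.filter fun g => R g U).card ≤
      N + ∑ P ∈ T, (Finset.univ.filter fun g => R g P.1 ∧ R g P.2).card := by
    have e1 := Finset.sum_card_bipartiteAbove_eq_sum_card_bipartiteBelow (s := Finset.univ)
      (t := 𝓕) R
    have e2 := Finset.sum_card_bipartiteAbove_eq_sum_card_bipartiteBelow (s := Finset.univ)
      (t := T) (fun g P => R g P.1 ∧ R g P.2)
    simp only [Finset.bipartiteAbove, Finset.bipartiteBelow] at e1 e2
    rw [← e1, ← e2, hN, ← Finset.card_univ, Finset.card_eq_sum_ones, ← Finset.sum_add_distrib]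
    exact Finset.sum_le_sum fun g _ => hchain g
  have hleft : N * 𝓕.card ≤ M * ∑ U ∈ 𝓕, (Finset.univ.filter fun g => R g U).card := by
    rw [mul_comm, ← smul_eq_mul, ← Finset.sum_const, Finset.mul_sum]
    refine Finset.sum_le_sum fun U _ => ?_
    rw [hN, card_eq_flagCount_self_mul (hE' U).symm, mul_comm]
    refine Nat.mul_le_mul (gaussBinom_le_half _ _) ?_
    simp [flagCount, R]
  have hright : (∑ P ∈ T, (Finset.univ.filter fun g => R g P.1 ∧ R g P.2).card) * B ≤
      T.card * (C * N) := by
    rw [Finset.sum_mul, ← smul_eq_mul, ← Finset.sum_const]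
    refine Finset.sum_le_sum fun P hP => ?_
    simp only [hT, Finset.mem_filter, Finset.mem_product] at hP
    refine (Nat.mul_le_mul_left _ (hB _ hP.1.2)).trans ?_
    rw [mul_left_comm]
    exact Nat.mul_le_mul_left _ (flagCount_mul_le (D := E (Module.finrank F P.1))
          (E := E (Module.finrank F P.2)) hP.2
        (h1 _ hP.1.1))
  refine Nat.le_of_mul_le_mul_left (c := N) ?_ hNpos
  calc N * (B * 𝓕.card) = (N * 𝓕.card) * B := by ring
    _ ≤ (M * (N + ∑ P ∈ T, (Finset.univ.filter fun g => R g P.1 ∧ R g P.2).card)) * B := by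
        exact Nat.mul_le_mul_right _ (hleft.trans (Nat.mul_le_mul_left _ hsum))
    _ = M * (N * B + (∑ P ∈ T, (Finset.univ.filter fun g => R g P.1 ∧ R g P.2).card) * B) := by
        ring
    _ ≤ M * (N * B + T.card * (C * N)) := by gcongr
    _ = N * (M * (B + C * T.card)) := by ring

end

theorem card_finrank_gt_le (r : ℕ) :
    ((Finset.univ.filter fun U : Submodule F (Fin n → F) =>
      n / 2 + r < Module.finrank F U).card : ℝ) ≤
        2 * (1 / 2) ^ r * gaussBinom F n (n / 2) := by
  have hmap : ∀ U ∈ Finset.univ.filter fun U : Submodule F (Fin n → F) =>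
      n / 2 + r < Module.finrank F U,
      Module.finrank F U - (n / 2 + r + 1) ∈ Finset.range (n + 1) := by
    intro U _
    have := U.finrank_le
    rw [Module.finrank_fin_fun] at this
    rw [Finset.mem_range]
    omega
  rw [Finset.card_eq_sum_card_fiberwise hmap]
  push_cast
  calc _ ≤ ∑ j ∈ Finset.range (n + 1),
        (1 / 2 : ℝ) ^ j * ((1 / 2) ^ r * gaussBinom F n (n / 2)) := by
        refine Finset.sum_le_sum fun j _ => ?_
        have h1 : (Finset.filter (fun U : Submodule F (Fin n → F) =>
            Module.finrank F U - (n / 2 + r + 1) = j)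
            (Finset.univ.filter fun U : Submodule F (Fin n → F) =>
              n / 2 + r < Module.finrank F U)).card ≤ gaussBinom F n (n / 2 + (r + j + 1)) := by
          rw [gaussBinom_eq_card_filter]
          refine Finset.card_le_card fun U hU => ?_
          simp only [Finset.mem_filter, Finset.mem_univ, true_and] at hU ⊢
          omega
        have h2 : 2 ^ (r + j) * gaussBinom F n (n / 2 + (r + j + 1)) ≤
            gaussBinom F n (n / 2) := by
          by_cases h : n / 2 + (r + j + 1) ≤ n
          · exact two_pow_mul_gaussBinom_add_le h
          · simp [gaussBinom_eq_zero (F := F) (not_le.1 h)]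
        have h2' : (2 : ℝ) ^ (r + j) * gaussBinom F n (n / 2 + (r + j + 1)) ≤
            gaussBinom F n (n / 2) := by exact_mod_cast h2
        refine (Nat.cast_le.2 h1).trans ?_
        rw [← mul_assoc, ← pow_add, one_div, inv_pow, add_comm j r, inv_mul_eq_div,
          le_div_iff₀' (by positivity)]
        exact h2'
    _ ≤ _ := by
        rw [← Finset.sum_mul, mul_assoc 2]
        gcongr
        exact sum_geometric_two_le _

theorem card_finrank_lt_le (r : ℕ) :
    ((Finset.univ.filter fun U : Submodule F (Fin n → F) =>
      Module.finrank F U + r < n / 2).card : ℝ) ≤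
        (1 / 2) ^ r * gaussBinom F n (n / 2) := by
  have hmap : ∀ U ∈ Finset.univ.filter fun U : Submodule F (Fin n → F) =>
      Module.finrank F U + r < n / 2,
      n / 2 - r - 1 - Module.finrank F U ∈ Finset.range (n + 1) := by
    intro U _
    rw [Finset.mem_range]
    omega
  rw [Finset.card_eq_sum_card_fiberwise hmap]
  push_cast
  calc _ ≤ ∑ j ∈ Finset.range (n + 1),
        (1 / 2 : ℝ) ^ j * ((1 / 2) ^ (r + 1) * gaussBinom F n (n / 2)) := by
        refine Finset.sum_le_sum fun j _ => ?_
        by_cases h : r + 1 + j ≤ n / 2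
        · have h1 : (Finset.filter (fun U : Submodule F (Fin n → F) =>
              n / 2 - r - 1 - Module.finrank F U = j)
              (Finset.univ.filter fun U : Submodule F (Fin n → F) =>
                Module.finrank F U + r < n / 2)).card ≤
                gaussBinom F n (n / 2 - (r + 1 + j)) := by
            rw [gaussBinom_eq_card_filter]
            refine Finset.card_le_card fun U hU => ?_
            simp only [Finset.mem_filter, Finset.mem_univ, true_and] at hU ⊢
            omega
          have h2 : (2 : ℝ) ^ (r + 1 + j) * gaussBinom F n (n / 2 - (r + 1 + j)) ≤
              gaussBinom F n (n / 2) := by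
            exact_mod_cast two_pow_mul_gaussBinom_sub_le (F := F) h
          refine (Nat.cast_le.2 h1).trans ?_
          rw [← mul_assoc, ← pow_add, one_div, inv_pow, add_comm j (r + 1), inv_mul_eq_div,
            le_div_iff₀' (by positivity)]
          exact h2
        · rw [Finset.card_eq_zero.2, Nat.cast_zero]
          · positivity
          · rw [Finset.filter_eq_empty_iff]
            intro U hU
            simp only [Finset.mem_filter, Finset.mem_univ, true_and] at hU
            omega
    _ ≤ _ := by
        rw [← Finset.sum_mul, pow_succ]
        calc _ ≤ 2 * ((1 / 2 : ℝ) ^ r * (1 / 2) * gaussBinom F n (n / 2)) := by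
              gcongr
              exact sum_geometric_two_le _
          _ = _ := by ring

theorem card_submodule_le :
    (Fintype.card (Submodule F (Fin n → F)) : ℝ) ≤ 4 * gaussBinom F n (n / 2) := by
  have h1 := card_finrank_gt_le (F := F) (n := n) 0
  have h2 := card_finrank_lt_le (F := F) (n := n) 0
  have h3 : Fintype.card (Submodule F (Fin n → F)) ≤
      (Finset.univ.filter fun U : Submodule F (Fin n → F) => n / 2 + 0 < Module.finrank F U).card +
      (Finset.univ.filter fun U : Submodule F (Fin n → F) => Module.finrank F U + 0 < n / 2).card +
      gaussBinom F n (n / 2) := by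
    rw [gaussBinom_eq_card_filter, ← Finset.card_univ]
    refine le_trans (Finset.card_le_card fun U _ => ?_)
      ((Finset.card_union_le _ _).trans (Nat.add_le_add_right (Finset.card_union_le _ _) _))
    simp only [Finset.mem_union, Finset.mem_filter, Finset.mem_univ, true_and]
    omega
  have h3' : (Fintype.card (Submodule F (Fin n → F)) : ℝ) ≤ _ := Nat.cast_le.2 h3
  push_cast at h3'
  linarith

end Flags

open scoped Classical in
/-- Supersaturation: a family of subspaces larger than the middle layer by a constant factor
contains a subspace comparable to at least a constant multiple of `q ^ (n / 2)` others. -/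
theorem exists_large_comparability_degree {q : ℕ} (hq : 2 ≤ q) {ε : ℝ} (hε : 0 < ε) :
    ∃ κ : ℝ, 0 < κ ∧ ∃ n0 : ℕ, ∀ n : ℕ, n0 ≤ n → ∀ (F : Type) [Field F] [Fintype F],
      Fintype.card F = q → ∀ 𝓕 : Finset (Submodule F (Fin n → F)),
        (1 + ε) * (gaussBinom F n (n / 2) : ℝ) ≤ 𝓕.card →
          ∃ U ∈ 𝓕, κ * (q : ℝ) ^ ((n : ℝ) / 2) ≤ (𝓕.filter fun W => U < W ∨ W < U).card := by
  obtain ⟨r, hr⟩ := exists_pow_lt_of_lt_one (show 0 < ε / 6 by positivity)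
    (show (1 / 2 : ℝ) < 1 by norm_num)
  set C : ℕ := q ^ ((2 * r + 2) * r) with hC
  have hq0 : (0 : ℝ) < q := by positivity
  have hC0 : (0 : ℝ) < C := by rw [hC]; positivity
  refine ⟨ε / (16 * C * q ^ (r + 2)), by positivity, 2 * r + 4, fun n hn F _ _ hF 𝓕 h𝓕 => ?_⟩
  have := Fintype.ofFinite (Submodule F (Fin n → F))
  have : Finite ((Fin n → F) ≃ₗ[F] (Fin n → F)) := DFunLike.finite _
  have := Fintype.ofFinite ((Fin n → F) ≃ₗ[F] (Fin n → F))
  set M := gaussBinom F n (n / 2) with hM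
  have hMpos : 0 < M := by
    have := pow_le_gaussBinom (F := F) (n := n) (k := n / 2) (by omega)
    exact lt_of_lt_of_le (by positivity) this
  have hMpos' : (0 : ℝ) < M := by exact_mod_cast hMpos
  set 𝓖 := 𝓕.filter fun U : Submodule F (Fin n → F) =>
    n / 2 ≤ Module.finrank F U + r ∧ Module.finrank F U ≤ n / 2 + r with h𝓖
  have h𝓖card : (1 + ε / 2) * (M : ℝ) ≤ 𝓖.card := by
    have h1 := card_finrank_gt_le (F := F) (n := n) r
    have h2 := card_finrank_lt_le (F := F) (n := n) r
    have h3 : 𝓕.card ≤ 𝓖.card +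
        (Finset.univ.filter fun U : Submodule F (Fin n → F) =>
          n / 2 + r < Module.finrank F U).card +
        (Finset.univ.filter fun U : Submodule F (Fin n → F) =>
          Module.finrank F U + r < n / 2).card := by
      refine le_trans (Finset.card_le_card fun U hU => ?_)
        ((Finset.card_union_le _ _).trans (Nat.add_le_add_right (Finset.card_union_le _ _) _))
      simp only [h𝓖, Finset.mem_union, Finset.mem_filter, Finset.mem_univ, true_and, hU]
      omega
    have h3' : (𝓕.card : ℝ) ≤ _ := Nat.cast_le.2 h3
    push_cast at h3'
    have h4 : (1 / 2 : ℝ) ^ r * M ≤ ε / 6 * M := by gcongr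
    rw [← hM] at h1 h2
    linarith
  have hpairs := mul_card_le_of_pairs (F := F) (n := n) (𝓕 := 𝓖)
    (B := M * q ^ (n / 2 - r - 1)) (C := C)
    (fun U hU => by
      rw [h𝓖, Finset.mem_filter] at hU
      omega)
    (fun U hU => by
      rw [h𝓖, Finset.mem_filter] at hU
      rw [hF, ← mul_assoc]
      refine Nat.mul_le_mul ?_ (Nat.pow_le_pow_right (by omega) (by omega))
      have := gaussBinom_half_le (F := F) (n := n) (r := r) (k := Module.finrank F U)
        (by omega) hU.2.1 hU.2.2
      rwa [hF] at this)
  rw [← hM] at hpairs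
  by_contra! hdeg
  set d := ε / (16 * C * q ^ (r + 2)) * (q : ℝ) ^ ((n : ℝ) / 2) with hd
  have hT : (((𝓖 ×ˢ 𝓖).filter fun P => P.1 < P.2).card : ℝ) ≤ 4 * M * d := by
    have hmap : ∀ P ∈ (𝓖 ×ˢ 𝓖).filter fun P => P.1 < P.2, P.1 ∈ 𝓖 := by
      intro P hP
      rw [Finset.mem_filter, Finset.mem_product] at hP
      exact hP.1.1
    rw [Finset.card_eq_sum_card_fiberwise hmap]
    push_cast
    calc _ ≤ ∑ _U ∈ 𝓖, d := by
          refine Finset.sum_le_sum fun U hU => ?_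
          refine le_trans (Nat.cast_le.2 ?_)
            (hdeg U (Finset.filter_subset _ _ hU)).le
          refine Finset.card_le_card_of_injOn Prod.snd (fun P hP => ?_) (fun P hP Q hQ h => ?_)
          · simp only [Finset.coe_filter, Finset.mem_filter, Finset.mem_product,
              Set.mem_ofPred_eq, h𝓖] at hP ⊢
            exact ⟨hP.1.1.2.1, Or.inl (hP.2 ▸ hP.1.2)⟩
          · simp only [Finset.coe_filter, Set.mem_ofPred_eq] at hP hQ
            exact Prod.ext (hP.2.trans hQ.2.symm) h
      _ = 𝓖.card * d := by simp
      _ ≤ _ := by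
          have : (𝓖.card : ℝ) ≤ Fintype.card (Submodule F (Fin n → F)) :=
            Nat.cast_le.2 (Finset.card_le_univ _)
          have := this.trans card_submodule_le
          have hd0 : 0 ≤ d := by positivity
          gcongr
  have hqpow : (q : ℝ) ^ ((n : ℝ) / 2) ≤ q ^ (r + 2) * q ^ (n / 2 - r - 1) := by
    rw [← pow_add, ← Real.rpow_natCast]
    refine Real.rpow_le_rpow_of_exponent_le (by exact_mod_cast (by omega : 1 ≤ q)) ?_
    rw [div_le_iff₀ (by norm_num)]
    exact_mod_cast (by omega : n ≤ (r + 2 + (n / 2 - r - 1)) * 2)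
  set Q : ℝ := (q : ℝ) ^ (n / 2 - r - 1) with hQ
  have hQ0 : 0 < Q := by positivity
  have hdQ : C * d ≤ ε / 16 * Q := by
    calc C * d ≤ C * (ε / (16 * C * q ^ (r + 2)) * (q ^ (r + 2) * Q)) := by
          rw [hd]; gcongr
      _ = _ := by field_simp
  have hp : (M * Q) * 𝓖.card ≤ M * (M * Q + C * ((𝓖 ×ˢ 𝓖).filter fun P => P.1 < P.2).card) := by
    rw [hQ]
    exact_mod_cast hpairs
  have h5 : M * Q * ((1 + ε / 2) * M) ≤ M * (M * Q + C * (4 * M * d)) := by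
    refine le_trans ?_ (hp.trans ?_) <;> gcongr
  have h6 : M * (C * (4 * M * d)) ≤ 4 * (M * M) * (ε / 16 * Q) := by
    calc _ = 4 * (M * M : ℝ) * (C * d) := by ring
      _ ≤ _ := by gcongr
  have h7 : 0 < (M : ℝ) * M * Q * ε := by positivity
  nlinarith

/-- Kleitman–Winston containers: if every set of size at least `R` contains a vertex with at least
`d` neighbours inside it, then every independent set is covered by a small fingerprint `S` and a
container of size less than `R` that depends only on `S`. -/
theorem exists_containers {α : Type*} [DecidableEq α] {r : α → α → Prop} [DecidableRel r]
    {R d : ℝ}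
    (hdeg : ∀ X : Finset α, R ≤ X.card → ∃ v ∈ X, d ≤ (X.filter (r v)).card) (X : Finset α) :
    ∃ C : Finset α → Finset α, (∀ S, ((C S).card : ℝ) < R) ∧
      ∀ I ⊆ X, (∀ u ∈ I, ∀ v ∈ I, ¬ r u v) →
        ∃ S ⊆ I, S.card * d ≤ X.card ∧ I ⊆ S ∪ C S := by
  induction X using Finset.strongInduction with
  | H X ih =>
  rcases lt_or_ge (X.card : ℝ) R with hX | hX
  · exact ⟨fun _ => X, fun _ => hX, fun I hI _ => ⟨∅, by simp, by simp, by simpa using hI⟩⟩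
  · obtain ⟨v, hv, hvd⟩ := hdeg X hX
    set Y := (X.erase v).filter fun w => ¬ r v w with hY
    have h1 : X.erase v ⊂ X := Finset.erase_ssubset hv
    have h2 : Y ⊂ X := (Finset.filter_subset _ _).trans_ssubset h1
    have hYcard : (Y.card : ℝ) + d ≤ X.card := by
      have h3 : Y.card ≤ (X.filter fun w => ¬ r v w).card :=
        Finset.card_le_card (Finset.filter_subset_filter _ h1.subset)
      have h4 := Finset.card_filter_add_card_filter_not (s := X) (r v)
      have h3' : (Y.card : ℝ) ≤ (X.filter fun w => ¬ r v w).card := Nat.cast_le.2 h3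
      have h4' : ((X.filter (r v)).card : ℝ) + (X.filter fun w => ¬ r v w).card = X.card := by
        exact_mod_cast h4
      linarith
    obtain ⟨C₁, hC₁, hI₁⟩ := ih _ h1
    obtain ⟨C₂, hC₂, hI₂⟩ := ih _ h2
    refine ⟨fun S => if v ∈ S then C₂ (S.erase v) else C₁ S, fun S => ?_, fun I hI hind => ?_⟩
    · dsimp only
      split_ifs
      exacts [hC₂ _, hC₁ _]
    · by_cases hvI : v ∈ I
      · obtain ⟨S, hS, hScard, hSI⟩ := hI₂ (I.erase v)
          (fun w hw => by
            rw [Finset.mem_erase] at hw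
            exact Finset.mem_filter.2 ⟨Finset.mem_erase.2 ⟨hw.1, hI hw.2⟩, hind v hvI w hw.2⟩)
          (fun u hu w hw => hind u (Finset.mem_of_mem_erase hu) w (Finset.mem_of_mem_erase hw))
        have hvS : v ∉ S := fun h => Finset.notMem_erase v I (hS h)
        refine ⟨insert v S, ?_, ?_, ?_⟩
        · exact Finset.insert_subset hvI (hS.trans (Finset.erase_subset _ _))
        · rw [Finset.card_insert_of_notMem hvS]
          push_cast
          linarith
        · simp only [Finset.mem_insert_self, if_true, Finset.erase_insert hvS]
          rw [Finset.insert_union, ← Finset.insert_erase hvI]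
          exact Finset.insert_subset_insert _ hSI
      · obtain ⟨S, hS, hScard, hSI⟩ := hI₁ I
          (fun w hw => Finset.mem_erase.2 ⟨fun h => hvI (h ▸ hw), hI hw⟩) hind
        refine ⟨S, hS, hScard.trans (Nat.cast_le.2 (Finset.card_le_card h1.subset)), ?_⟩
        dsimp only
        rwa [if_neg fun h => hvI (hS h)]

open scoped ENNReal in
/-- A Chernoff-type bound for the event that a random set contains `S` and at least `a` elements
of a set `C` disjoint from `S`. No measurability of the membership events is needed. -/
theorem measure_subset_and_large_le {α Ω : Type*} [DecidableEq α] [MeasurableSpace Ω]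
    {μ : Measure Ω} {A : Ω → Set α} {p : ℝ≥0∞}
    (hA : ∀ T : Finset α, μ {ω | (T : Set α) ⊆ A ω} = p ^ T.card) {S C : Finset α}
    (hSC : Disjoint S C) (t : ℝ≥0∞) (a : ℕ) :
    (1 + t) ^ a * μ {ω | (S : Set α) ⊆ A ω ∧ ∃ J ⊆ C, (J : Set α) ⊆ A ω ∧ a ≤ J.card} ≤
      p ^ S.card * (1 + t * p) ^ C.card := by
  set E : Finset α → Set Ω := fun T => toMeasurable μ {ω | ((S ∪ T : Finset α) : Set α) ⊆ A ω}
    with hE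
  have hEmeas (T : Finset α) : MeasurableSet (E T) := measurableSet_toMeasurable _ _
  set f : Ω → ℝ≥0∞ := fun ω => ∑ T ∈ C.powerset, (E T).indicator (fun _ => t ^ T.card) ω with hf
  have hfmeas : Measurable f :=
    Finset.measurable_sum _ fun T _ => measurable_const.indicator (hEmeas T)
  have hint : ∫⁻ ω, f ω ∂μ = p ^ S.card * (1 + t * p) ^ C.card := by
    rw [hf, lintegral_finsetSum _ fun T _ => measurable_const.indicator (hEmeas T), add_comm,
      ← Finset.sum_pow_mul_eq_add_pow, Finset.mul_sum]
    refine Finset.sum_congr rfl fun T hT => ?_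
    rw [lintegral_indicator_const (hEmeas T), hE, measure_toMeasurable, hA,
      Finset.card_union_of_disjoint (hSC.mono_right (Finset.mem_powerset.1 hT))]
    rw [one_pow, mul_one, mul_pow, pow_add]
    ring
  rw [← hint]
  refine le_trans ?_ (mul_meas_ge_le_lintegral hfmeas ((1 + t) ^ a))
  refine mul_le_mul' le_rfl (measure_mono ?_)
  rintro ω ⟨hS, J, hJC, hJ, hJa⟩
  change (1 + t) ^ a ≤ f ω
  calc (1 + t) ^ a ≤ (1 + t) ^ J.card := pow_le_pow_right₀ le_self_add hJa
    _ = ∑ T ∈ J.powerset, t ^ T.card := by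
        rw [add_comm, ← Finset.sum_pow_mul_eq_add_pow]
        simp
    _ = ∑ T ∈ J.powerset, (E T).indicator (fun _ => t ^ T.card) ω := by
        refine Finset.sum_congr rfl fun T hT => ?_
        rw [Set.indicator_of_mem]
        refine subset_toMeasurable _ _ ?_
        change ((S ∪ T : Finset α) : Set α) ⊆ A ω
        rw [Finset.coe_union]
        exact Set.union_subset hS
          ((Finset.coe_subset.2 (Finset.mem_powerset.1 hT)).trans hJ)
    _ ≤ f ω := Finset.sum_le_sum_of_subset (Finset.powerset_mono.2 hJC)

/-- A random sparse version of the container bound: independent sets in a `p`-random subset are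
unlikely to be much larger than `p * R`. -/
theorem measure_exists_large_independent_le {α Ω : Type*} [Fintype α]
    {r : α → α → Prop} {R d : ℝ} (hd : 0 < d)
    (hdeg : ∀ X : Finset α, R ≤ X.card →
      ∃ v ∈ X, d ≤ (Set.ncard {w | w ∈ X ∧ r v w} : ℝ))
    [MeasurableSpace Ω] {μ : Measure Ω} {A : Ω → Set α} {p : ℝ} (hp : 0 ≤ p)
    (hA : ∀ T : Finset α, μ {ω | (T : Set α) ⊆ A ω} = ENNReal.ofReal p ^ T.card)
    {s t x : ℝ} (hs : (Fintype.card α : ℝ) ≤ s * d) (ht : 0 ≤ t) (hx : 0 < x) (hx1 : x ≤ 1)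
    (y : ℝ) :
    μ {ω | ∃ I : Finset α, (I : Set α) ⊆ A ω ∧ (∀ u ∈ I, ∀ v ∈ I, ¬ r u v) ∧ y < I.card} ≤
      ENNReal.ofReal (Real.exp (s * Real.log x⁻¹ + x * p * Fintype.card α + t * p * R
        - Real.log (1 + t) * (y - s))) := by
  classical
  have hdeg' : ∀ X : Finset α, R ≤ X.card → ∃ v ∈ X, d ≤ (X.filter (r v)).card := by
    intro X hX
    obtain ⟨v, hv, hvd⟩ := hdeg X hX
    refine ⟨v, hv, hvd.trans_eq ?_⟩
    rw [← Set.ncard_coe_finset, Finset.coe_filter]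
  obtain ⟨C, hC, hI⟩ := exists_containers hdeg' Finset.univ
  set a := ⌈y - s⌉₊ with ha
  set 𝓢 : Finset (Finset α) := Finset.univ.filter fun S => (S.card : ℝ) ≤ s with h𝓢
  set Ev : Finset α → Set Ω := fun S =>
    {ω | (S : Set α) ⊆ A ω ∧ ∃ J ⊆ C S \ S, (J : Set α) ⊆ A ω ∧ a ≤ J.card} with hEv
  have hsub : {ω | ∃ I : Finset α, (I : Set α) ⊆ A ω ∧ (∀ u ∈ I, ∀ v ∈ I, ¬ r u v) ∧
      y < I.card} ⊆ ⋃ S ∈ 𝓢, Ev S := by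
    rintro ω ⟨I, hIA, hind, hy⟩
    obtain ⟨S, hSI, hScard, hIS⟩ := hI I (Finset.subset_univ _) hind
    have hSs : (S.card : ℝ) ≤ s := by
      rw [Finset.card_univ] at hScard
      exact le_of_mul_le_mul_right (hScard.trans hs) hd
    refine Set.mem_biUnion (show S ∈ (𝓢 : Set (Finset α)) by simpa [h𝓢] using hSs) ?_
    refine ⟨(Finset.coe_subset.2 hSI).trans hIA, I \ S, ?_, ?_, ?_⟩
    · intro w hw
      rw [Finset.mem_sdiff] at hw ⊢
      exact ⟨(Finset.mem_union.1 (hIS hw.1)).resolve_left hw.2, hw.2⟩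
    · exact (Finset.coe_subset.2 Finset.sdiff_subset).trans hIA
    · rw [ha, Nat.ceil_le, Finset.cast_card_sdiff hSI]
      linarith
  have hEvle (S : Finset α) : μ (Ev S) ≤ ENNReal.ofReal
      (p ^ S.card * Real.exp (t * p * R - Real.log (1 + t) * (y - s))) := by
    have h := measure_subset_and_large_le hA (Finset.disjoint_sdiff (s := S) (t := C S))
      (ENNReal.ofReal t) a
    rw [← ENNReal.ofReal_one, ← ENNReal.ofReal_mul ht, ← ENNReal.ofReal_add zero_le_one ht,
      ← ENNReal.ofReal_add zero_le_one (by positivity), ← ENNReal.ofReal_pow (by positivity),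
      ← ENNReal.ofReal_pow hp, ← ENNReal.ofReal_pow (by positivity),
      ← ENNReal.ofReal_mul (by positivity)] at h
    have hpos : 0 < (1 + t) ^ a := by positivity
    rw [mul_comm, ← ENNReal.le_div_iff_mul_le (by simp [hpos]) (by simp),
      ← ENNReal.ofReal_div_of_pos hpos] at h
    refine h.trans (ENNReal.ofReal_le_ofReal ?_)
    rw [mul_div_assoc, Real.exp_sub]
    gcongr
    · calc (1 + t * p) ^ (C S \ S).card ≤ Real.exp (t * p) ^ (C S \ S).card := by
            gcongr
            linarith [Real.add_one_le_exp (t * p)]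
        _ = Real.exp (t * p * (C S \ S).card) := by rw [mul_comm (t * p), Real.exp_nat_mul]
        _ ≤ _ := by
            gcongr
            refine le_trans ?_ (hC S).le
            exact Nat.cast_le.2 (Finset.card_le_card Finset.sdiff_subset)
    · rw [mul_comm]
      calc Real.exp ((y - s) * Real.log (1 + t)) ≤ Real.exp (a * Real.log (1 + t)) := by
            gcongr
            · exact Real.log_nonneg (by linarith)
            · exact Nat.le_ceil _
        _ = _ := by rw [Real.exp_nat_mul, Real.exp_log (by linarith)]
  have hsum : ∑ S ∈ 𝓢, p ^ S.card ≤
      Real.exp (s * Real.log x⁻¹ + x * p * Fintype.card α) := by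
    calc ∑ S ∈ 𝓢, p ^ S.card ≤ ∑ S ∈ 𝓢, (x * p) ^ S.card * Real.exp (s * Real.log x⁻¹) := by
          refine Finset.sum_le_sum fun S hS => ?_
          have hSs : (S.card : ℝ) ≤ s := by simpa [h𝓢] using hS
          have hlog : 0 ≤ Real.log x⁻¹ := Real.log_nonneg ((one_le_inv₀ hx).2 hx1)
          have h1 : x⁻¹ ^ S.card ≤ Real.exp (s * Real.log x⁻¹) := by
            rw [← Real.exp_log (inv_pos.2 hx), ← Real.exp_nat_mul, Real.log_exp]
            gcongr
          calc p ^ S.card = (x * p) ^ S.card * x⁻¹ ^ S.card := by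
                rw [← mul_pow, mul_right_comm, mul_inv_cancel₀ hx.ne', one_mul]
            _ ≤ _ := by gcongr
      _ ≤ ∑ S : Finset α, (x * p) ^ S.card * Real.exp (s * Real.log x⁻¹) :=
          Finset.sum_le_univ_sum_of_nonneg fun S => by positivity
      _ = (x * p + 1) ^ Fintype.card α * Real.exp (s * Real.log x⁻¹) := by
          rw [← Finset.sum_mul, ← Finset.card_univ, ← Finset.sum_pow_mul_eq_add_pow]
          simp
      _ ≤ Real.exp (x * p) ^ Fintype.card α * Real.exp (s * Real.log x⁻¹) := by
          gcongr
          exact Real.add_one_le_exp _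
      _ = _ := by
          rw [← Real.exp_nat_mul, ← Real.exp_add]
          congr 1
          ring
  calc _ ≤ μ (⋃ S ∈ 𝓢, Ev S) := measure_mono hsub
    _ ≤ ∑ S ∈ 𝓢, μ (Ev S) := measure_biUnion_finset_le _ _
    _ ≤ ∑ S ∈ 𝓢, ENNReal.ofReal
        (p ^ S.card * Real.exp (t * p * R - Real.log (1 + t) * (y - s))) :=
        Finset.sum_le_sum fun S _ => hEvle S
    _ = ENNReal.ofReal ((∑ S ∈ 𝓢, p ^ S.card) *
        Real.exp (t * p * R - Real.log (1 + t) * (y - s))) := by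
        rw [← ENNReal.ofReal_sum_of_nonneg fun S _ => by positivity, Finset.sum_mul]
    _ ≤ ENNReal.ofReal (Real.exp (s * Real.log x⁻¹ + x * p * Fintype.card α) *
        Real.exp (t * p * R - Real.log (1 + t) * (y - s))) := by gcongr
    _ = _ := by
        rw [← Real.exp_add]
        congr 2
        ring

/-- The numerical parameters used to bound antichains in random subsets. -/
theorem exists_antichain_constants {ε : ℝ} (hε : 0 < ε) :
    ∃ t η x β : ℝ, 0 < t ∧ 0 < η ∧ 0 < x ∧ x ≤ 1 ∧ 0 < β ∧
      η * Real.log x⁻¹ + 4 * x + t * (1 + ε / 2) - Real.log (1 + t) * (1 + ε - η) ≤ -β := by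
  set t := (ε / 4) / (1 + ε / 2) with ht
  have ht0 : 0 < t := by positivity
  have htε : t * (1 + ε / 2) = ε / 4 := by rw [ht]; field_simp
  set l := Real.log (1 + t) with hl
  have hl0 : 0 < l := Real.log_pos (by linarith)
  have hlt : t ≤ l * (1 + t) := by
    have h := Real.one_sub_inv_le_log_of_pos (show 0 < 1 + t by linarith)
    have h2 : (1 - (1 + t)⁻¹) * (1 + t) = t := by field_simp; ring
    calc t = (1 - (1 + t)⁻¹) * (1 + t) := h2.symm
      _ ≤ _ := by gcongr
  set β := l * (1 + ε) - t * (1 + ε / 2) with hβ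
  have hβ0 : 0 < β := by
    have h1 : t * (1 + ε / 2) ≤ l * (1 + t) * (1 + ε / 2) := by gcongr
    have h2 : (1 + t) * (1 + ε / 2) = 1 + 3 * ε / 4 := by linarith
    have h3 : 0 < l * ε := by positivity
    rw [mul_assoc, h2] at h1
    rw [hβ]
    linarith
  set x := min 1 (β / 16) with hx
  have hx0 : 0 < x := lt_min one_pos (by positivity)
  have hx1 : x ≤ 1 := min_le_left _ _
  have hxβ : x ≤ β / 16 := min_le_right _ _
  have hL : 0 ≤ Real.log x⁻¹ := Real.log_nonneg ((one_le_inv₀ hx0).2 hx1)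
  refine ⟨t, (β / 4) / (Real.log x⁻¹ + l), x, β / 2, ht0, by positivity, hx0, hx1,
    by positivity, ?_⟩
  have h : (β / 4) / (Real.log x⁻¹ + l) * (Real.log x⁻¹ + l) = β / 4 :=
    div_mul_cancel₀ _ (by positivity)
  linarith

/-- With high probability, every antichain in a `p`-random subset of the poset of
subspaces of `F_q^n` has cardinality at most `(1+ε) p [n choose ⌊n/2⌋]_q`,
provided `p ≥ c(ε,q)/q^{n/2}`.  The `p`-random subset is modelled as a random set `A`
on an arbitrary probability space whose membership events are independent and each
have probability `p`. -/
theorem randomVecSpAntichain (q : ℕ) (hq : IsPrimePow q) (ε : ℝ) (hε : 0 < ε) :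
    ∃ c : ℝ, 0 < c ∧ ∀ δ : ℝ, 0 < δ → ∃ n0 : ℕ, ∀ n : ℕ, n0 ≤ n →
      ∀ (F : Type) [Field F] [Fintype F], Fintype.card F = q →
        ∀ p : ℝ, c / (q : ℝ) ^ ((n : ℝ) / 2) ≤ p → p ≤ 1 →
          ∀ (Ω : Type) [MeasurableSpace Ω] (μ : Measure Ω) [IsProbabilityMeasure μ]
            (A : Ω → Set (Submodule F (Fin n → F))),
            iIndepSet (fun W => {ω | W ∈ A ω}) μ →
            (∀ W : Submodule F (Fin n → F), μ {ω | W ∈ A ω} = ENNReal.ofReal p) →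
            ENNReal.ofReal (1 - δ) ≤
              μ {ω | ∀ I : Finset (Submodule F (Fin n → F)),
                  (I : Set (Submodule F (Fin n → F))) ⊆ A ω →
                  IsAntichain (· ≤ ·) (I : Set (Submodule F (Fin n → F))) →
                  (I.card : ℝ) ≤ (1 + ε) * p * (gaussBinom F n (n / 2) : ℝ)} := by
  have hq2 : 2 ≤ q := hq.two_le
  have hq1 : (1 : ℝ) < q := by exact_mod_cast hq2
  obtain ⟨κ, hκ, n1, hn1⟩ := exists_large_comparability_degree hq2 (half_pos hε)
  obtain ⟨t, η, x, β, ht, hη, hx, hx1, hβ, hexp⟩ := exists_antichain_constants hε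
  refine ⟨4 / (κ * η), by positivity, fun δ hδ => ?_⟩
  set c := 4 / (κ * η) with hc
  have hc0 : 0 < c := by positivity
  have hlim : Filter.Tendsto (fun n : ℕ => Real.exp (-(β * (c * (q : ℝ) ^ ((n : ℝ) / 2)))))
      Filter.atTop (nhds 0) := by
    have h := (tendsto_rpow_atTop_of_base_gt_one _ hq1).comp
      (tendsto_natCast_atTop_atTop.atTop_div_const two_pos)
    exact Real.tendsto_exp_neg_atTop_nhds_zero.comp ((h.const_mul_atTop hc0).const_mul_atTop hβ)
  obtain ⟨n2, hn2⟩ := Filter.eventually_atTop.1 (hlim.eventually_le_const hδ)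
  refine ⟨max 4 (max n1 n2), fun n hn F _ _ hF p hp hp1 Ω _ μ _ A hind hprob => ?_⟩
  have hn4 : 4 ≤ n := (le_max_left _ _).trans hn
  have hnn1 : n1 ≤ n := ((le_max_left _ _).trans (le_max_right _ _)).trans hn
  have hnn2 : n2 ≤ n := ((le_max_right _ _).trans (le_max_right _ _)).trans hn
  have := Fintype.ofFinite (Submodule F (Fin n → F))
  set Q : ℝ := (q : ℝ) ^ ((n : ℝ) / 2) with hQ
  have hQ0 : 0 < Q := by positivity
  have hp0 : 0 < p := lt_of_lt_of_le (by positivity) hp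
  rw [div_le_iff₀ hQ0] at hp
  set M : ℝ := (gaussBinom F n (n / 2) : ℝ) with hM
  have hMQ : Q * Q ≤ M := by
    have h1 := pow_le_gaussBinom (F := F) (n := n) (k := n / 2) (by omega)
    rw [hF] at h1
    have h2 : n ≤ n / 2 * (n - n / 2) := by
      have h3 : 2 * (n - n / 2) ≤ n / 2 * (n - n / 2) := Nat.mul_le_mul_right _ (by omega)
      omega
    have h3 : q ^ n ≤ gaussBinom F n (n / 2) :=
      (Nat.pow_le_pow_right (by omega) h2).trans h1
    rw [hQ, ← Real.rpow_add (by positivity), add_halves, Real.rpow_natCast, hM]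
    exact_mod_cast h3
  have hM0 : 0 < M := lt_of_lt_of_le (by positivity) hMQ
  have hpM : c * Q ≤ p * M :=
    calc c * Q ≤ p * Q * Q := by gcongr
      _ = p * (Q * Q) := mul_assoc _ _ _
      _ ≤ _ := by gcongr
  have hcard : (Fintype.card (Submodule F (Fin n → F)) : ℝ) ≤ 4 * M := card_submodule_le
  have hA (T : Finset (Submodule F (Fin n → F))) :
      μ {ω | (T : Set (Submodule F (Fin n → F))) ⊆ A ω} = ENNReal.ofReal p ^ T.card := by
    have h := (iIndepSet_iff _ _).1 hind T (f := fun W => {ω | W ∈ A ω})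
      (fun W _ => MeasurableSpace.measurableSet_generateFrom (Set.mem_singleton _))
    have h2 : {ω | (T : Set (Submodule F (Fin n → F))) ⊆ A ω} = ⋂ W ∈ T, {ω | W ∈ A ω} := by
      ext ω
      simp [Set.subset_def]
    rw [h2, h]
    simp [hprob]
  have hs : (Fintype.card (Submodule F (Fin n → F)) : ℝ) ≤ η * (p * M) * (κ * Q) := by
    refine hcard.trans ?_
    calc 4 * M = (κ * η) * c * M := by rw [hc]; field_simp
      _ ≤ (κ * η) * (p * Q) * M := by gcongr
      _ = _ := by ring
  have hbad := measure_exists_large_independent_le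
    (r := fun U W : Submodule F (Fin n → F) => U < W ∨ W < U)
    (R := (1 + ε / 2) * M) (d := κ * Q) (by positivity)
    (fun X hX => by
      obtain ⟨U, hU, hUd⟩ := hn1 n hnn1 F hF X hX
      refine ⟨U, hU, hUd.trans_eq ?_⟩
      rw [← Set.ncard_coe_finset, Finset.coe_filter])
    hp0.le hA hs ht.le hx hx1 ((1 + ε) * p * M)
  set N : ℝ := (Fintype.card (Submodule F (Fin n → F)) : ℝ)
  have hexponent : η * (p * M) * Real.log x⁻¹ + x * p * N + t * p * ((1 + ε / 2) * M) -
      Real.log (1 + t) * ((1 + ε) * p * M - η * (p * M)) ≤ -(β * (c * Q)) := by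
    calc _ ≤ η * (p * M) * Real.log x⁻¹ + x * p * (4 * M) + t * p * ((1 + ε / 2) * M) -
          Real.log (1 + t) * ((1 + ε) * p * M - η * (p * M)) := by gcongr
      _ = (p * M) * (η * Real.log x⁻¹ + 4 * x + t * (1 + ε / 2) -
          Real.log (1 + t) * (1 + ε - η)) := by ring
      _ ≤ (p * M) * -β := by gcongr
      _ = -(β * (p * M)) := by ring
      _ ≤ _ := by gcongr
  have hbad' := hbad.trans (ENNReal.ofReal_le_ofReal
    ((Real.exp_le_exp.2 hexponent).trans (hn2 n hnn2)))
  rw [ENNReal.ofReal_sub _ hδ.le, ENNReal.ofReal_one, tsub_le_iff_right, ← measure_univ (μ := μ)]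
  refine le_trans ?_ ((measure_union_le _ _).trans (add_le_add_right hbad' _))
  refine measure_mono fun ω _ => ?_
  by_contra h
  rw [Set.mem_union, not_or] at h
  refine h.1 fun I hI hanti => not_lt.1 fun hlt => h.2 ⟨I, hI, fun U hU W hW hr => ?_, hlt⟩
  rcases hr with hr | hr
  · exact hanti hU hW hr.ne hr.le
  · exact hanti hW hU hr.ne hr.le
end
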